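/- arXiv:1711.06105 — 7 statements merged into one kernel-verified Lean document; each statement's English description precedes it below -/
import Mathlib

section
/- Let R be a commutative noetherian ring and 𝒞 a class of finitely generated R-modules such that: (i) Ext^1_R(C, R) = 0 for every C in 𝒞; (ii) every C in 𝒞 fits into a short exact sequence 0 → C' → P → C → 0 with P finitely generated projective and C' in 𝒞; and (iii) every C in 𝒞 fits into a short exact sequence 0 → C → Q → C'' → 0 with Q finitely generated projective and C'' in 𝒞. Then every module in 𝒞 is Gorenstein projective. -/
open CategoryTheory TensorProduct

universe u

noncomputable section

/-- `X` admits a projective resolution of length at most `n` by finitely generated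
projective `S`-modules, i.e. the projective dimension of `X` over `S` is at most `n`. -/
def HasPdLE (S : Type u) [Ring S] (X : Type u) [AddCommGroup X] [Module S X]
    (n : ℕ) : Prop :=
  ∃ (P : ℕ → ModuleCat.{u} S) (d : ∀ i : ℕ, P (i + 1) →ₗ[S] P i) (ε : P 0 →ₗ[S] X),
    (∀ i, Module.Projective S (P i)) ∧ (∀ i, Module.Finite S (P i)) ∧
    Function.Surjective ε ∧
    LinearMap.ker ε = LinearMap.range (d 0) ∧
    (∀ i, LinearMap.ker (d i) = LinearMap.range (d (i + 1))) ∧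
    (∀ i, n < i → Subsingleton (P i))

/-- `G` is a Gorenstein projective `S`-module: `G` is the zeroth cocycle of an acyclic
unbounded cochain complex of finitely generated projective `S`-modules whose dual
complex `Hom_S(-, S)` is also acyclic. -/
def IsGorensteinProjective (S : Type u) [Ring S] (G : Type u) [AddCommGroup G] [Module S G] :
    Prop :=
  ∃ (P : ℤ → ModuleCat.{u} S) (d : ∀ i : ℤ, P i →ₗ[S] P (i + 1)),
    (∀ i, Module.Finite S (P i)) ∧
    (∀ i, Module.Projective S (P i)) ∧
    (∀ i, LinearMap.range (d i) = LinearMap.ker (d (i + 1))) ∧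
    (∀ i : ℤ, Function.Exact
      (fun φ : P (i + 1 + 1) →ₗ[S] S => φ.comp (d (i + 1)))
      (fun φ : P (i + 1) →ₗ[S] S => φ.comp (d i))) ∧
    Nonempty (G ≃ₗ[S] LinearMap.ker (d 0))

/-- `X` has Gorenstein projective dimension at most `n` over `S`: there is an exact sequence
`0 → G^{-n} → ⋯ → G^{-1} → G^0 → X → 0` with each `G^{-i}` a finitely generated
Gorenstein projective `S`-module. -/
def HasGpdLE (S : Type u) [Ring S] (X : Type u) [AddCommGroup X] [Module S X] (n : ℕ) : Prop :=
  ∃ (P : ℕ → ModuleCat.{u} S) (d : ∀ i : ℕ, P (i + 1) →ₗ[S] P i) (ε : P 0 →ₗ[S] X),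
    (∀ i, IsGorensteinProjective S (P i)) ∧ (∀ i, Module.Finite S (P i)) ∧
    Function.Surjective ε ∧
    LinearMap.ker ε = LinearMap.range (d 0) ∧
    (∀ i, LinearMap.ker (d i) = LinearMap.range (d (i + 1))) ∧
    (∀ i, n < i → Subsingleton (P i))

/-- `Tor_i^R(A, B) = 0`. -/
def TorVanishes (R : Type u) [CommRing R] (A B : Type u) [AddCommGroup A] [Module R A]
    [AddCommGroup B] [Module R B] (i : ℕ) : Prop :=
  Subsingleton (((Tor (ModuleCat.{u} R) i).obj (ModuleCat.of R A)).obj (ModuleCat.of R B))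

/-- `Ext^i_S(N, X) = 0`. -/
def ExtVanishes (S : Type u) [Ring S] (N X : Type u) [AddCommGroup N] [Module S N]
    [AddCommGroup X] [Module S X] (i : ℕ) : Prop :=
  Subsingleton
    ((((Ext ℤ (ModuleCat.{u} S) i).obj (Opposite.op (ModuleCat.of S N))).obj (ModuleCat.of S X)))

variable (R : Type u) [CommRing R] (M : Type u) [AddCommGroup M] [Module R M]

/-- The iterated tensor power `M^{⊗_R n}`, with `M^{⊗_R 0} = R` and
`M^{⊗_R (n+1)} = M ⊗_R M^{⊗_R n}`. -/
def tpow : ℕ → ModuleCat.{u} R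
  | 0 => ModuleCat.of R R
  | n + 1 => ModuleCat.of R (M ⊗[R] tpow n)

/-- `M` is nilpotent: some tensor power `M^{⊗_R (N+1)}` vanishes. -/
def Module.IsNilpotentMod : Prop := ∃ N : ℕ, Subsingleton (tpow R M (N + 1))

/-- `M` is perfect: `M` has finite projective dimension over `R` and
`Tor_j^R(M, M^{⊗_R i}) = 0` for all `i, j ≥ 1`. -/
def Module.IsPerfectMod : Prop :=
  (∃ n, HasPdLE R M n) ∧
    ∀ i j : ℕ, 1 ≤ i → 1 ≤ j → TorVanishes R M (tpow R M i) j

/-- `M` is admissible: `Ext^1_R(G, M^{⊗_R i}) = 0 = Tor_1^R(M, M^{⊗_R i} ⊗_R G)` for every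
finitely generated Gorenstein projective `R`-module `G` and every `i ≥ 0`. -/
def Module.IsAdmissibleMod : Prop :=
  ∀ (G : Type u) [AddCommGroup G] [Module R G], Module.Finite R G →
    IsGorensteinProjective R G → ∀ i : ℕ,
      ExtVanishes R G (tpow R M i) 1 ∧ TorVanishes R M ((tpow R M i) ⊗[R] G) 1

/-- The action map `M ⊗_R X → X`, `m ⊗ x ↦ (ι m)·x`, of a module `X` over the
tensor ring `T_R(M)`. -/
def actionMap (X : Type u) [AddCommGroup X] [Module R X]
    [Module (TensorAlgebra R M) X] [IsScalarTower R (TensorAlgebra R M) X] :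
    M ⊗[R] X →ₗ[R] X :=
  TensorProduct.lift
    { toFun := fun m =>
        { toFun := fun x => TensorAlgebra.ι R m • x
          map_add' := fun x y => smul_add _ x y
          map_smul' := fun r x => by
            simp only [RingHom.id_apply]
            exact smul_comm (TensorAlgebra.ι R m) r x }
      map_add' := by intro m m'; ext x; simp [add_smul]
      map_smul' := by intro r m; ext x; simp [smul_assoc] }

end

open Limits in
/-- If `Ext¹(X, Y)` vanishes, every `1`-cocycle of a projective resolution of `X` with values in
`Y` is a coboundary. -/
theorem exists_d_comp_eq_of_ext_one_subsingleton {A : Type*} [Category* A] [Abelian A]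
    [EnoughProjectives A] {X Y : A} (P : ProjectiveResolution X)
    (h : Subsingleton (((Ext ℤ A 1).obj (Opposite.op X)).obj Y))
    (φ : P.complex.X 1 ⟶ Y) (hφ : P.complex.d 2 1 ≫ φ = 0) :
    ∃ ψ : P.complex.X 0 ⟶ Y, P.complex.d 1 0 ≫ ψ = φ := by
  have hz : IsZero ((P.complex.linearYonedaObj ℤ Y).homology 1) :=
    (ModuleCat.isZero_of_subsingleton _).of_iso (P.isoExt 1 Y).symm
  rw [← HomologicalComplex.exactAt_iff_isZero_homology,
    HomologicalComplex.exactAt_iff' _ 0 1 2 (by simp) (by simp),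
    ShortComplex.moduleCat_exact_iff] at hz
  exact hz φ hφ

/-- A linear map vanishing on the kernel of a surjection factors through it. -/
theorem LinearMap.exists_comp_eq_of_surjective {S M N L : Type*} [Ring S] [AddCommGroup M]
    [AddCommGroup N] [AddCommGroup L] [Module S M] [Module S N] [Module S L] {s : M →ₗ[S] N}
    (hs : Function.Surjective s) (t : M →ₗ[S] L) (h : LinearMap.ker s ≤ LinearMap.ker t) :
    ∃ g : N →ₗ[S] L, g.comp s = t := by
  refine ⟨((LinearMap.ker s).liftQ t h).comp (s.quotKerEquivOfSurjective hs).symm.toLinearMap, ?_⟩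
  ext x
  have hx : (s.quotKerEquivOfSurjective hs).symm (s x) = (LinearMap.ker s).mkQ x := by
    rw [LinearEquiv.symm_apply_eq]
    rfl
  simp [hx]

/-- If `Ext¹(X, Y)` vanishes, linear maps to `Y` extend along any monomorphism with
cokernel `X`. -/
theorem ExtVanishes.exists_extension {S : Type u} [Ring S] {K M X Y : Type u}
    [AddCommGroup K] [Module S K] [AddCommGroup M] [Module S M] [AddCommGroup X] [Module S X]
    [AddCommGroup Y] [Module S Y] (h : ExtVanishes S X Y 1) {i : K →ₗ[S] M} {p : M →ₗ[S] X}
    (hi : Function.Injective i) (hp : Function.Surjective p)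
    (hip : LinearMap.range i = LinearMap.ker p) (φ : K →ₗ[S] Y) :
    ∃ ψ : M →ₗ[S] Y, ψ.comp i = φ := by
  let P := ProjectiveResolution.of (ModuleCat.of S X)
  let ε : P.complex.X 0 ⟶ ModuleCat.of S X := P.π.f 0
  have hε : P.complex.d 1 0 ≫ ε = 0 := P.complex_d_comp_π_f_zero
  let f := ModuleCat.ofHom i
  let g := ModuleCat.ofHom p
  have : Mono f := (ModuleCat.mono_iff_injective f).2 hi
  have : Epi g := (ModuleCat.epi_iff_surjective g).2 hp
  have hfg : f ≫ g = 0 := by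
    ext x
    exact hip.le ⟨x, rfl⟩
  have hex : (ShortComplex.mk f g hfg).Exact :=
    (ShortComplex.moduleCat_exact_iff_range_eq_ker _).2 hip
  let a : P.complex.X 0 ⟶ ModuleCat.of S M := Projective.factorThru ε g
  have ha : a ≫ g = ε := Projective.factorThru_comp ε g
  have hda : (P.complex.d 1 0 ≫ a) ≫ g = 0 := by rw [Category.assoc, ha, hε]
  let b : P.complex.X 1 ⟶ ModuleCat.of S K :=
    hex.lift (P.complex.d 1 0 ≫ a) hda
  have hb : b ≫ f = P.complex.d 1 0 ≫ a := hex.lift_f _ hda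
  have hdb : P.complex.d 2 1 ≫ b = 0 := by
    rw [← cancel_mono f, Category.assoc, hb]
    simp
  obtain ⟨ψ, hψ⟩ := exists_d_comp_eq_of_ext_one_subsingleton P h (b ≫ ModuleCat.ofHom φ)
    (by rw [← Category.assoc, hdb, Limits.zero_comp])
  have hεsurj : Function.Surjective ε :=
    (ModuleCat.epi_iff_surjective ε).1 (inferInstanceAs (Epi (P.π.f 0)))
  have hεker : ∀ x, ε x = 0 → ∃ y, P.complex.d 1 0 y = x :=
    (ShortComplex.moduleCat_exact_iff _).1 P.exact₀
  have ha' (x) : p (a x) = ε x := ConcreteCategory.congr_hom ha x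
  have hb' (x) : i (b x) = a (P.complex.d 1 0 x) := ConcreteCategory.congr_hom hb x
  have hψ' (x) : ψ (P.complex.d 1 0 x) = φ (b x) := ConcreteCategory.congr_hom hψ x
  have hpi (x) : p (i x) = 0 := hip.le ⟨x, rfl⟩
  obtain ⟨χ, hχ⟩ := LinearMap.exists_comp_eq_of_surjective (s := i.coprod a.hom)
    (by
      intro m
      obtain ⟨x, hx⟩ := hεsurj (p m)
      obtain ⟨k, hk⟩ : m - a x ∈ LinearMap.range i := by
        rw [hip, LinearMap.mem_ker, map_sub, ha', hx, sub_self]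
      refine ⟨(k, x), ?_⟩
      rw [LinearMap.coprod_apply, hk]
      exact sub_add_cancel _ _)
    (φ.coprod ψ.hom)
    (by
      rintro ⟨k, x⟩ hkx
      replace hkx : i k + a x = 0 := hkx
      change φ k + ψ x = 0
      have hx : ε x = 0 := by
        have := congrArg p hkx
        rwa [map_add, hpi, ha', zero_add, map_zero] at this
      obtain ⟨y, rfl⟩ := hεker x hx
      have hk : k + b y = 0 := hi (by rw [map_add, hb', hkx, map_zero])
      rw [hψ', ← map_add, hk, map_zero])
  refine ⟨χ, ?_⟩
  ext k
  simpa using LinearMap.congr_fun hχ (k, 0)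

/-- A complex of finitely generated projective modules spliced from short exact sequences
`0 → Z i → P i → Z (i + 1) → 0` with `Ext¹(Z i, S) = 0` for all `i` witnesses that `Z 0` is
Gorenstein projective. -/
theorem IsGorensteinProjective.of_shortExact {S : Type u} [Ring S] (Z P : ℤ → ModuleCat.{u} S)
    (i : ∀ n, Z n →ₗ[S] P n) (p : ∀ n, P n →ₗ[S] Z (n + 1))
    (hExt : ∀ n, ExtVanishes S (Z n) S 1)
    (hproj : ∀ n, Module.Projective S (P n)) (hfin : ∀ n, Module.Finite S (P n))
    (hi : ∀ n, Function.Injective (i n)) (hp : ∀ n, Function.Surjective (p n))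
    (hip : ∀ n, LinearMap.range (i n) = LinearMap.ker (p n)) :
    IsGorensteinProjective S (Z 0) := by
  have hker (n) : LinearMap.ker ((i (n + 1)).comp (p n)) = LinearMap.ker (p n) :=
    LinearMap.ker_comp_of_ker_eq_bot _ (LinearMap.ker_eq_bot.2 (hi _))
  refine ⟨P, fun n => (i (n + 1)).comp (p n), hfin, hproj, fun n => ?_, fun n φ => ?_, ?_⟩
  · rw [hker, LinearMap.range_comp_of_range_eq_top _ (LinearMap.range_eq_top.2 (hp n)), hip]
  · constructor
    · intro hφ
      have hφi : LinearMap.ker (p (n + 1)) ≤ LinearMap.ker φ := by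
        rw [← hip]
        rintro _ ⟨z, rfl⟩
        obtain ⟨x, rfl⟩ := hp n z
        exact LinearMap.congr_fun hφ x
      obtain ⟨g, rfl⟩ := LinearMap.exists_comp_eq_of_surjective (hp (n + 1)) φ hφi
      obtain ⟨ψ, rfl⟩ := (hExt _).exists_extension (hi _) (hp _) (hip _) g
      exact ⟨ψ, rfl⟩
    · rintro ⟨ψ, rfl⟩
      ext x
      have hx : p (n + 1) (i (n + 1) (p n x)) = 0 := (hip (n + 1)).le ⟨_, rfl⟩
      simp [hx]
  · exact ⟨(LinearEquiv.ofInjective _ (hi 0)).trans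
      (LinearEquiv.ofEq _ _ ((hip 0).trans (hker 0).symm))⟩

/-- A relation that is total in both directions admits a bi-infinite chain through any point. -/
theorem exists_int_chain {α : Type*} {r : α → α → Prop} (hpred : ∀ a, ∃ b, r b a)
    (hsucc : ∀ a, ∃ b, r a b) (a : α) : ∃ z : ℤ → α, z 0 = a ∧ ∀ n, r (z n) (z (n + 1)) := by
  choose f hf using hpred
  choose g hg using hsucc
  refine ⟨fun
    | .ofNat n => g^[n] a
    | .negSucc n => f^[n + 1] a, rfl, ?_⟩
  rintro (n | _ | n)
  · change r (g^[n] a) (g^[n + 1] a)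
    rw [Function.iterate_succ_apply']
    exact hg _
  · exact hf a
  · change r (f^[n + 1 + 1] a) (f^[n + 1] a)
    rw [Function.iterate_succ_apply' f (n + 1)]
    exact hf _

/-- Let `𝒞` be a class of finitely generated `R`-modules with `Ext^1_R(C, R) = 0` for all
`C ∈ 𝒞`, closed under syzygies and cosyzygies with respect to finitely generated
projective modules as in the hypotheses. Then every module in `𝒞` is Gorenstein
projective. -/
theorem stmt_9 (R : Type u) [CommRing R] [IsNoetherianRing R]
    (𝒞 : ModuleCat.{u} R → Prop)
    (hfg : ∀ C, 𝒞 C → Module.Finite R C)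
    (hExt : ∀ C, 𝒞 C → ExtVanishes R C R 1)
    (hsyz : ∀ C, 𝒞 C → ∃ (C' P : ModuleCat.{u} R) (ι : C' →ₗ[R] P) (π : P →ₗ[R] C),
      𝒞 C' ∧ Module.Projective R P ∧ Module.Finite R P ∧
        Function.Injective ι ∧ Function.Surjective π ∧ LinearMap.range ι = LinearMap.ker π)
    (hcosyz : ∀ C, 𝒞 C → ∃ (Q C'' : ModuleCat.{u} R) (ι : C →ₗ[R] Q) (π : Q →ₗ[R] C''),
      𝒞 C'' ∧ Module.Projective R Q ∧ Module.Finite R Q ∧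
        Function.Injective ι ∧ Function.Surjective π ∧ LinearMap.range ι = LinearMap.ker π) :
    ∀ C, 𝒞 C → IsGorensteinProjective R C := by
  intro C hC
  let r (A B : {C // 𝒞 C}) : Prop := ∃ (P : ModuleCat.{u} R) (ι : A.1 →ₗ[R] P) (π : P →ₗ[R] B.1),
    Module.Projective R P ∧ Module.Finite R P ∧ Function.Injective ι ∧ Function.Surjective π ∧
      LinearMap.range ι = LinearMap.ker π
  have hpred (B) : ∃ A, r A B := by
    obtain ⟨A, P, ι, π, hA, h⟩ := hsyz B.1 B.2
    exact ⟨⟨A, hA⟩, P, ι, π, h⟩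
  have hsucc (A) : ∃ B, r A B := by
    obtain ⟨P, B, ι, π, hB, h⟩ := hcosyz A.1 A.2
    exact ⟨⟨B, hB⟩, P, ι, π, h⟩
  obtain ⟨Z, hZ, hr⟩ := exists_int_chain hpred hsucc ⟨C, hC⟩
  choose P ι π hproj hfin hι hπ hex using hr
  have key := IsGorensteinProjective.of_shortExact (fun n => (Z n).1) P ι π
    (fun n => hExt _ (Z n).2) hproj hfin hι hπ hex
  rwa [hZ] at key
end

section
/- Let R be a commutative noetherian ring such that the injective dimension of R as a module over itself is at most d (equivalently, Ext^i_R(N, R) = 0 for every finitely generated R-module N and every i > d). Then every finitely generated R-module X has Gorenstein projective dimension at most d, i.e., there is an exact sequence 0 → G^{-d} → ⋯ → G^{-1} → G^0 → X → 0 with each G^{-i} a finitely generated Gorenstein projective R-module. -/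
open CategoryTheory TensorProduct

universe u

section

variable {R : Type u}

section Bridge

variable [Ring R]

/-- Vanishing of `Ext` defined by left derived functors implies vanishing of `Ext` defined in
the derived category, in positive degrees. -/
theorem ExtVanishes.subsingleton_abelianExt {N X : Type u} [AddCommGroup N] [Module R N]
    [AddCommGroup X] [Module R X] {i : ℕ} (h : ExtVanishes R N X (i + 1)) :
    Subsingleton (Abelian.Ext (ModuleCat.of R N) (ModuleCat.of R X) (i + 1)) := by
  let Q := ProjectiveResolution.of (ModuleCat.of R N)
  refine subsingleton_of_forall_eq 0 fun α ↦ ?_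
  obtain ⟨f, hf, rfl⟩ := Q.extMk_surjective α (i + 2) rfl
  rw [Q.extMk_eq_zero_iff f (i + 2) rfl hf i rfl]
  have hzero : Limits.IsZero
      ((Q.complex.linearYonedaObj ℤ (ModuleCat.of R X)).homology (i + 1)) := by
    refine Limits.IsZero.of_iso ?_ (Q.isoExt (R := ℤ) (i + 1) (ModuleCat.of R X)).symm
    have : Subsingleton _ := h
    exact ModuleCat.isZero_of_subsingleton _
  rw [← HomologicalComplex.exactAt_iff_isZero_homology,
    HomologicalComplex.exactAt_iff' _ i (i + 1) (i + 2) (by simp) (by simp),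
    ShortComplex.moduleCat_exact_iff] at hzero
  exact hzero f hf

theorem shortExact_ofHom {K P N : Type u} [AddCommGroup K] [Module R K]
    [AddCommGroup P] [Module R P] [AddCommGroup N] [Module R N]
    {f : K →ₗ[R] P} {g : P →ₗ[R] N} (hf : Function.Injective f) (hg : Function.Surjective g)
    (hfg : Function.Exact f g) :
    (ShortComplex.mk (ModuleCat.ofHom f) (ModuleCat.ofHom g)
      (by ext x; exact hfg.apply_apply_eq_zero x)).ShortExact where
  exact := (ShortComplex.ShortExact.moduleCat_exact_iff_function_exact _).2 hfg
  mono_f := (ModuleCat.mono_iff_injective _).2 hf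
  epi_g := (ModuleCat.epi_iff_surjective _).2 hg

/-- If `Ext¹(N, X) = 0`, maps to `X` extend along the kernel of any surjection onto `N`. -/
theorem exists_comp_eq_of_subsingleton_ext {K P N X : Type u} [AddCommGroup K] [Module R K]
    [AddCommGroup P] [Module R P] [AddCommGroup N] [Module R N] [AddCommGroup X] [Module R X]
    [Subsingleton (Abelian.Ext (ModuleCat.of R N) (ModuleCat.of R X) 1)]
    {f : K →ₗ[R] P} {g : P →ₗ[R] N} (hf : Function.Injective f) (hg : Function.Surjective g)
    (hfg : Function.Exact f g) (φ : K →ₗ[R] X) : ∃ ψ : P →ₗ[R] X, ψ ∘ₗ f = φ := by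
  have hS := shortExact_ofHom hf hg hfg
  obtain ⟨y, hy⟩ := Abelian.Ext.contravariant_sequence_exact₁ hS (ModuleCat.of R X)
    (Abelian.Ext.mk₀ (ModuleCat.ofHom φ)) (add_zero 1) (Subsingleton.elim (α :=
      Abelian.Ext (ModuleCat.of R N) (ModuleCat.of R X) 1) _ _)
  obtain ⟨ψ, rfl⟩ := (Abelian.Ext.mk₀_bijective _ _).2 y
  rw [Abelian.Ext.mk₀_comp_mk₀] at hy
  exact ⟨ψ.hom, congrArg ModuleCat.Hom.hom ((Abelian.Ext.mk₀_bijective _ _).1 hy)⟩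

end Bridge

section Syzygy

variable [Ring R]

/-- `M` is a first syzygy of `N`: there is a short exact sequence `0 → M → P → N → 0` with `P`
finitely generated projective. -/
def IsSyzygy (M N : ModuleCat.{u} R) : Prop :=
  ∃ (P : ModuleCat.{u} R) (f : M →ₗ[R] P) (g : P →ₗ[R] N),
    Module.Finite R P ∧ Module.Projective R P ∧ Function.Injective f ∧
      Function.Surjective g ∧ Function.Exact f g

/-- `M` is an `n`-th syzygy of some finitely generated module. -/
def IsNthSyzygy : ℕ → ModuleCat.{u} R → Prop
  | 0, M => Module.Finite R M
  | n + 1, M => ∃ N, IsNthSyzygy n N ∧ IsSyzygy M N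

theorem exists_isSyzygy (N : ModuleCat.{u} R) [Module.Finite R N] : ∃ K, IsSyzygy K N := by
  obtain ⟨n, g, hg⟩ := Module.Finite.exists_fin' R N
  exact ⟨ModuleCat.of R (LinearMap.ker g), ModuleCat.of R (Fin n → R),
    (LinearMap.ker g).subtype, g, inferInstanceAs (Module.Finite R (Fin n → R)),
    inferInstanceAs (Module.Projective R (Fin n → R)), Subtype.val_injective, hg,
    LinearMap.exact_subtype_ker_map g⟩

theorem IsSyzygy.subsingleton_ext {M N : ModuleCat.{u} R} (h : IsSyzygy M N) (X : ModuleCat.{u} R)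
    {i : ℕ} (hN : Subsingleton (Abelian.Ext N X (i + 2))) :
    Subsingleton (Abelian.Ext M X (i + 1)) := by
  obtain ⟨P, f, g, -, hP, hf, hg, hfg⟩ := h
  have hS := shortExact_ofHom hf hg hfg
  have : Projective (ModuleCat.of R P) := (IsProjective.iff_projective (R := R) (P := P)).1 hP
  refine subsingleton_of_forall_eq 0 fun x ↦ ?_
  obtain ⟨y, rfl⟩ := Abelian.Ext.contravariant_sequence_exact₁ hS X x
    (add_comm 1 (i + 1)) (Subsingleton.elim (α := Abelian.Ext N X (i + 2)) _ _)
  rw [Abelian.Ext.eq_zero_of_projective y, Abelian.Ext.comp_zero]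

theorem IsNthSyzygy.subsingleton_ext {X : ModuleCat.{u} R} {d : ℕ}
    (hX : ∀ N : ModuleCat.{u} R, Module.Finite R N → ∀ i, d ≤ i →
      Subsingleton (Abelian.Ext N X (i + 1))) {n : ℕ} {M : ModuleCat.{u} R}
    (hM : IsNthSyzygy n M) {i : ℕ} (hi : d ≤ i + n) : Subsingleton (Abelian.Ext M X (i + 1)) := by
  induction n generalizing M i with
  | zero => exact hX M hM i hi
  | succ n ih =>
    obtain ⟨N, hN, hMN⟩ := hM
    exact hMN.subsingleton_ext X (ih hN (by lia))

theorem isNthSyzygy_of_projective (M : ModuleCat.{u} R) [Module.Finite R M]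
    [Module.Projective R M] (n : ℕ) : IsNthSyzygy n M := by
  induction n generalizing M with
  | zero => assumption
  | succ n ih =>
    refine ⟨ModuleCat.of R PUnit.{u + 1}, ih _, M, LinearMap.id, 0, ‹_›, ‹_›, Function.injective_id,
      fun x ↦ ⟨0, rfl⟩, fun x ↦ by simp⟩

variable [IsNoetherianRing R]

theorem IsSyzygy.finite {M N : ModuleCat.{u} R} (h : IsSyzygy M N) : Module.Finite R M := by
  obtain ⟨P, f, -, _, -, hf, -, -⟩ := h
  exact Module.Finite.of_injective f hf

theorem IsNthSyzygy.of_succ {n : ℕ} {M : ModuleCat.{u} R} (h : IsNthSyzygy (n + 1) M) :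
    IsNthSyzygy n M := by
  induction n generalizing M with
  | zero =>
    obtain ⟨N, -, hMN⟩ := h
    exact hMN.finite
  | succ n ih =>
    obtain ⟨N, hN, hMN⟩ := h
    exact ⟨N, ih hN, hMN⟩

theorem IsNthSyzygy.finite {n : ℕ} {M : ModuleCat.{u} R} (h : IsNthSyzygy n M) :
    Module.Finite R M := by
  cases n with
  | zero => exact h
  | succ n =>
    obtain ⟨N, -, hMN⟩ := h
    exact hMN.finite

end Syzygy

section TotallyAcyclic

variable [CommRing R]

/-- A bi-infinite chain of syzygies with vanishing `Ext¹(-, R)` splices to a totally acyclic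
complex of finitely generated projective modules. -/
theorem isGorensteinProjective_of_isSyzygy_int (Z : ℤ → ModuleCat.{u} R)
    (hZ : ∀ i, IsSyzygy (Z i) (Z (i + 1)))
    (hExt : ∀ i, Subsingleton (Abelian.Ext (Z i) (ModuleCat.of R R) 1)) :
    IsGorensteinProjective R (Z 0) := by
  choose P f g hfin hproj hf hg hfg using hZ
  have hker (i : ℤ) : LinearMap.ker (f (i + 1) ∘ₗ g i) = LinearMap.range (f i) := by
    rw [LinearMap.ker_comp_of_ker_eq_bot _ (LinearMap.ker_eq_bot.2 (hf _)),
      (hfg i).linearMap_ker_eq]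
  refine ⟨P, fun i ↦ f (i + 1) ∘ₗ g i, hfin, hproj, fun i ↦ ?_, fun i φ ↦ ⟨fun h ↦ ?_, ?_⟩,
    ⟨(LinearEquiv.ofInjective (f 0) (hf 0)).trans (LinearEquiv.ofEq _ _ (hker 0).symm)⟩⟩
  · rw [hker, LinearMap.range_comp_of_range_eq_top _ (LinearMap.range_eq_top.2 (hg i))]
  · have hφ : φ ∘ₗ f (i + 1) = 0 := by
      ext z
      obtain ⟨p, rfl⟩ := hg i z
      exact LinearMap.congr_fun h p
    obtain ⟨ψ, hψ⟩ := (LinearMap.exact_lcomp_of_exact_of_surjective R (hfg (i + 1)) (hg (i + 1)) φ).1 hφ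
    obtain ⟨χ, rfl⟩ := exists_comp_eq_of_subsingleton_ext (hf _) (hg _) (hfg (i + 1 + 1)) ψ
    exact ⟨χ, hψ⟩
  · rintro ⟨χ, rfl⟩
    ext p
    simp [(hfg (i + 1)).apply_apply_eq_zero]

/-- A class of modules with vanishing `Ext¹(-, R)` in which every module is a syzygy and has a
syzygy consists of Gorenstein projective modules. -/
theorem isGorensteinProjective_of_class (C : ModuleCat.{u} R → Prop)
    (hExt : ∀ M, C M → Subsingleton (Abelian.Ext M (ModuleCat.of R R) 1))
    (hpred : ∀ M, C M → ∃ K, C K ∧ IsSyzygy K M) (hsucc : ∀ M, C M → ∃ N, C N ∧ IsSyzygy M N)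
    (M : ModuleCat.{u} R) (hM : C M) : IsGorensteinProjective R M := by
  choose pred hpredC hpred using hpred
  choose succ hsuccC hsucc using hsucc
  let down : ℕ → { M // C M } := Nat.rec ⟨M, hM⟩ fun _ K ↦ ⟨pred K.1 K.2, hpredC K.1 K.2⟩
  let up : ℕ → { M // C M } := Nat.rec ⟨M, hM⟩ fun _ K ↦ ⟨succ K.1 K.2, hsuccC K.1 K.2⟩
  let Z : ℤ → { M // C M }
    | Int.ofNat n => up n
    | Int.negSucc n => down (n + 1)
  refine isGorensteinProjective_of_isSyzygy_int (fun i ↦ (Z i).1) (fun i ↦ ?_)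
    fun i ↦ hExt _ (Z i).2
  match i with
  | Int.ofNat n => exact hsucc _ (up n).2
  | Int.negSucc 0 => exact hpred M hM
  | Int.negSucc (n + 1) => exact hpred _ (down (n + 1)).2

end TotallyAcyclic

section Gpd

variable [Ring R]

theorem hasGpdLE_zero {X : Type u} [AddCommGroup X] [Module R X] [Module.Finite R X]
    (hX : IsGorensteinProjective R X) (h0 : IsGorensteinProjective R PUnit.{u + 1}) :
    HasGpdLE R X 0 := by
  let P : ℕ → ModuleCat.{u} R
    | 0 => ModuleCat.of R X
    | _ + 1 => ModuleCat.of R PUnit.{u + 1}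
  have hP (i : ℕ) : Subsingleton (P (i + 1)) := inferInstanceAs (Subsingleton PUnit.{u + 1})
  refine ⟨P, fun _ ↦ 0, (LinearMap.id : X →ₗ[R] X), ?_, ?_, Function.surjective_id, ?_,
    fun i ↦ Subsingleton.elim _ _, ?_⟩
  · rintro (_ | i)
    exacts [hX, h0]
  · rintro (_ | i)
    exacts [inferInstanceAs (Module.Finite R X), inferInstanceAs (Module.Finite R PUnit.{u + 1})]
  · exact LinearMap.ker_id.trans LinearMap.range_zero.symm
  · rintro (_ | i) hi
    exacts [absurd hi (lt_irrefl 0), hP i]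

theorem HasGpdLE.succ {K P X : Type u} [AddCommGroup K] [Module R K] [AddCommGroup P] [Module R P]
    [AddCommGroup X] [Module R X] [Module.Finite R P] {n : ℕ} (hK : HasGpdLE R K n)
    (hP : IsGorensteinProjective R P) {f : K →ₗ[R] P} {g : P →ₗ[R] X} (hf : Function.Injective f)
    (hg : Function.Surjective g) (hfg : Function.Exact f g) : HasGpdLE R X (n + 1) := by
  obtain ⟨Q, δ, ε, hQ, hQfin, hε, hε0, hδ, hQn⟩ := hK
  let Q' : ℕ → ModuleCat.{u} R
    | 0 => ModuleCat.of R P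
    | i + 1 => Q i
  let δ' : ∀ i, Q' (i + 1) →ₗ[R] Q' i
    | 0 => f ∘ₗ ε
    | i + 1 => δ i
  refine ⟨Q', δ', g, ?_, ?_, hg, ?_, ?_, ?_⟩
  · rintro (_ | i)
    exacts [hP, hQ i]
  · rintro (_ | i)
    exacts [inferInstanceAs (Module.Finite R P), hQfin i]
  · exact hfg.linearMap_ker_eq.trans
      (LinearMap.range_comp_of_range_eq_top f (LinearMap.range_eq_top.2 hε)).symm
  · rintro (_ | i)
    exacts [(LinearMap.ker_comp_of_ker_eq_bot ε (LinearMap.ker_eq_bot.2 hf)).trans hε0, hδ i]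
  · rintro (_ | i) hi
    exacts [absurd hi (Nat.not_lt_zero _), hQn i (Nat.lt_of_succ_lt_succ hi)]

end Gpd

section Duality

variable [CommRing R]

theorem surjective_dualMap_of_subsingleton_ext {K P N : Type u} [AddCommGroup K] [Module R K]
    [AddCommGroup P] [Module R P] [AddCommGroup N] [Module R N]
    [Subsingleton (Abelian.Ext (ModuleCat.of R N) (ModuleCat.of R R) 1)]
    {f : K →ₗ[R] P} {g : P →ₗ[R] N} (hf : Function.Injective f) (hg : Function.Surjective g)
    (hfg : Function.Exact f g) : Function.Surjective f.dualMap :=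
  exists_comp_eq_of_subsingleton_ext hf hg hfg

theorem exact_dualMap {K P N : Type u} [AddCommGroup K] [Module R K]
    [AddCommGroup P] [Module R P] [AddCommGroup N] [Module R N]
    {f : K →ₗ[R] P} {g : P →ₗ[R] N} (hg : Function.Surjective g)
    (hfg : Function.Exact f g) : Function.Exact g.dualMap f.dualMap :=
  LinearMap.exact_lcomp_of_exact_of_surjective R hfg hg

/-- Dualizing a short exact sequence `0 → M → P → N → 0` with `Ext¹(N, R) = 0` exhibits the dual
of `N` as a syzygy of the dual of `M`. -/
theorem IsSyzygy.dual {M N : ModuleCat.{u} R} (h : IsSyzygy M N)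
    [Subsingleton (Abelian.Ext N (ModuleCat.of R R) 1)] :
    IsSyzygy (ModuleCat.of R (Module.Dual R N)) (ModuleCat.of R (Module.Dual R M)) := by
  obtain ⟨P, f, g, _, _, hf, hg, hfg⟩ := h
  exact ⟨ModuleCat.of R (Module.Dual R P), g.dualMap, f.dualMap,
    inferInstanceAs (Module.Finite R (Module.Dual R P)),
    inferInstanceAs (Module.Projective R (Module.Dual R P)),
    LinearMap.dualMap_injective_of_surjective hg,
    surjective_dualMap_of_subsingleton_ext hf hg hfg, exact_dualMap hg hfg⟩

variable [IsNoetherianRing R] {d : ℕ}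

theorem Module.finite_dual_of_isNoetherianRing (M : ModuleCat.{u} R) [Module.Finite R M] :
    Module.Finite R (Module.Dual R M) := by
  obtain ⟨n, g, hg⟩ := Module.Finite.exists_fin' R M
  exact Module.Finite.of_injective g.dualMap (LinearMap.dualMap_injective_of_surjective hg)

theorem IsNthSyzygy.exists_isSyzygy {n : ℕ} {M : ModuleCat.{u} R} (hM : IsNthSyzygy n M) :
    ∃ K, IsNthSyzygy n K ∧ IsSyzygy K M := by
  have := hM.finite
  obtain ⟨K, hK⟩ := _root_.exists_isSyzygy M
  exact ⟨K, IsNthSyzygy.of_succ ⟨M, hM, hK⟩, hK⟩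

theorem IsNthSyzygy.dual
    (hd : ∀ M : ModuleCat.{u} R, IsNthSyzygy d M →
      Subsingleton (Abelian.Ext M (ModuleCat.of R R) 1))
    {M : ModuleCat.{u} R} (hM : IsNthSyzygy d M) (n : ℕ) :
    IsNthSyzygy n (ModuleCat.of R (Module.Dual R M)) := by
  induction n generalizing M with
  | zero =>
    have := hM.finite
    exact Module.finite_dual_of_isNoetherianRing M
  | succ n ih =>
    obtain ⟨K, hK, hKM⟩ := hM.exists_isSyzygy
    have := hd M hM
    exact ⟨_, ih hK, hKM.dual⟩

theorem IsNthSyzygy.surjective_dual_eval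
    (hd : ∀ M : ModuleCat.{u} R, IsNthSyzygy d M →
      Subsingleton (Abelian.Ext M (ModuleCat.of R R) 1))
    {M : ModuleCat.{u} R} (hM : IsNthSyzygy d M) : Function.Surjective (Module.Dual.eval R M) := by
  obtain ⟨K, hK, P, f, g, _, _, hf, hg, hfg⟩ := hM.exists_isSyzygy
  have := hd M hM
  have := hd _ (hK.dual hd d)
  have hgg : Function.Surjective g.dualMap.dualMap :=
    surjective_dualMap_of_subsingleton_ext (LinearMap.dualMap_injective_of_surjective hg)
      (surjective_dualMap_of_subsingleton_ext hf hg hfg) (exact_dualMap hg hfg)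
  intro x
  obtain ⟨y, rfl⟩ := hgg x
  obtain ⟨p, rfl⟩ := (Module.bijective_dual_eval R P).2 y
  exact ⟨g p, rfl⟩

theorem IsNthSyzygy.bijective_dual_eval
    (hd : ∀ M : ModuleCat.{u} R, IsNthSyzygy d M →
      Subsingleton (Abelian.Ext M (ModuleCat.of R R) 1))
    {M : ModuleCat.{u} R} (hM : IsNthSyzygy d M) : Function.Bijective (Module.Dual.eval R M) := by
  refine ⟨(injective_iff_map_eq_zero _).2 fun x hx ↦ ?_, hM.surjective_dual_eval hd⟩
  obtain ⟨K, hK, P, f, g, _, _, hf, hg, hfg⟩ := hM.exists_isSyzygy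
  have := hd M hM
  obtain ⟨p, rfl⟩ := hg x
  obtain ⟨y, hy⟩ := (exact_dualMap (surjective_dualMap_of_subsingleton_ext hf hg hfg)
    (exact_dualMap hg hfg) (Module.Dual.eval R P p)).1 hx
  obtain ⟨k, rfl⟩ := hK.surjective_dual_eval hd y
  obtain rfl : f k = p := (Module.bijective_dual_eval R P).1 hy
  exact hfg.apply_apply_eq_zero k

/-- A `d`-th syzygy is reflexive, hence the dual of a syzygy of its dual gives a cosyzygy. -/
theorem IsNthSyzygy.exists_isSyzygy_right
    (hd : ∀ M : ModuleCat.{u} R, IsNthSyzygy d M →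
      Subsingleton (Abelian.Ext M (ModuleCat.of R R) 1))
    {M : ModuleCat.{u} R} (hM : IsNthSyzygy d M) :
    ∃ N, IsNthSyzygy d N ∧ IsSyzygy M N := by
  have hM' := hM.dual hd d
  obtain ⟨L, hL, hLM⟩ := hM'.exists_isSyzygy
  have := hd _ hM'
  obtain ⟨P, f, g, hP, hP', hf, hg, hfg⟩ := hLM.dual
  let e := LinearEquiv.ofBijective _ (hM.bijective_dual_eval hd)
  exact ⟨_, hL.dual hd d, P, f ∘ₗ e.toLinearMap, g, hP, hP', hf.comp e.injective, hg,
    fun p ↦ (hfg p).trans (e.surjective.range_comp f ▸ Iff.rfl)⟩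

theorem IsNthSyzygy.isGorensteinProjective
    (hd : ∀ M : ModuleCat.{u} R, IsNthSyzygy d M →
      Subsingleton (Abelian.Ext M (ModuleCat.of R R) 1))
    {M : ModuleCat.{u} R} (hM : IsNthSyzygy d M) :
    IsGorensteinProjective R M :=
  isGorensteinProjective_of_class (IsNthSyzygy d) hd (fun _ h ↦ h.exists_isSyzygy)
    (fun _ h ↦ h.exists_isSyzygy_right hd) M hM

theorem IsNthSyzygy.hasGpdLE
    (hd : ∀ M : ModuleCat.{u} R, IsNthSyzygy d M →
      Subsingleton (Abelian.Ext M (ModuleCat.of R R) 1))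
    {k n : ℕ} (hkn : k + n = d) {M : ModuleCat.{u} R} (hM : IsNthSyzygy k M) : HasGpdLE R M n := by
  have := hM.finite
  induction n generalizing k M with
  | zero =>
    obtain rfl : k = d := hkn
    exact hasGpdLE_zero (hM.isGorensteinProjective hd)
      ((isNthSyzygy_of_projective (ModuleCat.of R PUnit.{u + 1}) k).isGorensteinProjective hd)
  | succ n ih =>
    obtain ⟨K, hK⟩ := _root_.exists_isSyzygy M
    have hgpd : HasGpdLE R K n := ih (k := k + 1) (by lia) ⟨M, hM, hK⟩ hK.finite
    obtain ⟨P, f, g, _, _, hf, hg, hfg⟩ := hK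
    exact hgpd.succ ((isNthSyzygy_of_projective P d).isGorensteinProjective hd) hf hg hfg

end Duality

end


/-- If `R` is a commutative noetherian ring with `Ext^i_R(N, R) = 0` for every finitely
generated `R`-module `N` and every `i > d`, then every finitely generated `R`-module has
Gorenstein projective dimension at most `d`. -/
theorem stmt_10 (R : Type u) [CommRing R] [IsNoetherianRing R] (d : ℕ)
    (hR : ∀ (N : Type u) [AddCommGroup N] [Module R N], Module.Finite R N →
      ∀ i : ℕ, d < i → ExtVanishes R N R i) :
    ∀ (X : Type u) [AddCommGroup X] [Module R X], Module.Finite R X →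
      HasGpdLE R X d := by
  intro X _ _ hX
  refine IsNthSyzygy.hasGpdLE (d := d) (fun M hM ↦ ?_) (zero_add d) (M := ModuleCat.of R X) hX
  refine hM.subsingleton_ext (fun N hN i hi ↦ ?_) (zero_add d).ge
  exact (hR N hN (i + 1) (Nat.lt_succ_of_le hi)).subsingleton_abelianExt
end

section
/- Let R be a commutative noetherian ring such that every finitely generated R-module has Gorenstein projective dimension at most d. Then Ext^i_R(X, R) = 0 for every finitely generated R-module X and every i > d; in particular the injective dimension of R as a module over itself is at most d. -/
open CategoryTheory TensorProduct

universe u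

/-- If the derived-category `Ext` vanishes in a positive degree, so does the derived-functor
`Ext`. -/
lemma isZero_Ext_of_subsingleton {A C : Type*} [Ring A] [Category* C] [Abelian C] [Linear A C]
    [EnoughProjectives C] [HasExt C] (X Y : C) (n : ℕ) [Subsingleton (Abelian.Ext X Y (n + 1))] :
    Limits.IsZero (((Ext A C (n + 1)).obj (Opposite.op X)).obj Y) := by
  let P := projectiveResolution X
  refine Limits.IsZero.of_iso ?_ (P.isoExt (n + 1) Y)
  rw [← HomologicalComplex.exactAt_iff_isZero_homology,
    HomologicalComplex.exactAt_iff' _ n (n + 1) (n + 2) (by simp) (by simp),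
    ShortComplex.moduleCat_exact_iff]
  intro (f : P.complex.X (n + 1) ⟶ Y) hf
  exact (P.extMk_eq_zero_iff f (n + 2) rfl hf n rfl).1 (Subsingleton.elim _ _)

namespace ModuleCat

variable {S : Type u} [Ring S]

/-- The short exact sequence `0 → ker g → M → N → 0` of a surjective linear map `g`. -/
lemma shortExact_ker {M N : Type u} [AddCommGroup M] [Module S M] [AddCommGroup N] [Module S N]
    (g : M →ₗ[S] N) (hg : Function.Surjective g) :
    (ShortComplex.mk (ModuleCat.ofHom (LinearMap.ker g).subtype) (ModuleCat.ofHom g)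
      (by ext x; exact x.2)).ShortExact where
  exact := by
    rw [ShortComplex.moduleCat_exact_iff]
    intro x hx
    exact ⟨⟨x, hx⟩, rfl⟩
  mono_f := (ModuleCat.mono_iff_injective _).2 Subtype.val_injective
  epi_g := (ModuleCat.epi_iff_surjective _).2 hg

/-- Dimension shifting along a surjection `g : M → N`. -/
lemma subsingleton_ext_of_ker {M N : Type u} [AddCommGroup M] [Module S M] [AddCommGroup N]
    [Module S N] (g : M →ₗ[S] N) (hg : Function.Surjective g) (Y : ModuleCat.{u} S) (n : ℕ)
    (hM : Subsingleton (Abelian.Ext (of S M) Y (n + 1)))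
    (hK : Subsingleton (Abelian.Ext (of S (LinearMap.ker g)) Y n)) :
    Subsingleton (Abelian.Ext (of S N) Y (n + 1)) := by
  refine subsingleton_of_forall_eq 0 fun x => ?_
  obtain ⟨y, rfl⟩ := Abelian.Ext.contravariant_sequence_exact₃ (shortExact_ker g hg) Y x
    (hM.elim _ _) (add_comm 1 n)
  rw [hK.elim y 0, Abelian.Ext.comp_zero]

/-- `Ext¹(N, Y)` vanishes if `N` is the target of a surjection `g : M → N` with `M` projective
such that every linear map `ker g → Y` extends to `M`. -/
lemma subsingleton_ext_one_of_extends {M N : Type u} [AddCommGroup M] [Module S M]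
    [AddCommGroup N] [Module S N] [Module.Projective S M] (g : M →ₗ[S] N)
    (hg : Function.Surjective g) (Y : ModuleCat.{u} S)
    (h : ∀ φ : LinearMap.ker g →ₗ[S] Y, ∃ ψ : M →ₗ[S] Y, ∀ x : LinearMap.ker g, ψ x = φ x) :
    Subsingleton (Abelian.Ext (of S N) Y 1) := by
  have : Projective (of S M) := (IsProjective.iff_projective _).1 ‹_›
  refine subsingleton_of_forall_eq 0 fun x => ?_
  obtain ⟨y, rfl⟩ := Abelian.Ext.contravariant_sequence_exact₃ (shortExact_ker g hg) Y x
    (Abelian.Ext.eq_zero_of_projective _) (add_comm 1 0)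
  obtain ⟨φ, rfl⟩ := Abelian.Ext.addEquiv₀.symm.surjective y
  obtain ⟨ψ, hψ⟩ := h φ.hom
  obtain rfl : ofHom (LinearMap.ker g).subtype ≫ ofHom ψ = φ := by ext x; exact hψ x
  have hcomp := (shortExact_ker g hg).extClass_comp
  rw [Abelian.Ext.addEquiv₀_symm_apply, ← Abelian.Ext.mk₀_comp_mk₀,
    ← Abelian.Ext.comp_assoc_of_third_deg_zero, hcomp, Abelian.Ext.zero_comp]

end ModuleCat

namespace IsGorensteinProjective

variable {S : Type u} [Ring S] {G : Type u} [AddCommGroup G] [Module S G]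

lemma of_linearEquiv {H : Type u} [AddCommGroup H] [Module S H]
    (hG : IsGorensteinProjective S G) (e : H ≃ₗ[S] G) : IsGorensteinProjective S H := by
  obtain ⟨P, d, hfin, hproj, hex, hdual, ⟨f⟩⟩ := hG
  exact ⟨P, d, hfin, hproj, hex, hdual, ⟨e.trans f⟩⟩

/-- Gorenstein projective modules have no higher extensions by the ring. -/
lemma subsingleton_ext (hG : IsGorensteinProjective S G) (n : ℕ) :
    Subsingleton (Abelian.Ext (ModuleCat.of S G) (ModuleCat.of S S) (n + 1)) := by
  obtain ⟨P, d, -, hproj, hex, hdual, ⟨e⟩⟩ := hG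
  suffices H : ∀ (n : ℕ) (j : ℤ), Subsingleton
      (Abelian.Ext (ModuleCat.of S (LinearMap.ker (d j))) (ModuleCat.of S S) (n + 1)) by
    refine subsingleton_of_forall_eq 0 fun x => ?_
    rw [← Abelian.Ext.mk₀_id_comp x, ← e.toModuleIso.hom_inv_id, ← Abelian.Ext.mk₀_comp_mk₀_assoc,
      (H n 0).elim ((Abelian.Ext.mk₀ _).comp x _) 0, Abelian.Ext.comp_zero]
  -- The surjection from `P i` onto the next cocycle module.
  let π (i : ℤ) : P i →ₗ[S] LinearMap.ker (d (i + 1)) :=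
    (d i).codRestrict _ fun x => (hex i).le ⟨x, rfl⟩
  have hπ (i : ℤ) : Function.Surjective (π i) := by
    rintro ⟨x, hx⟩
    obtain ⟨y, rfl⟩ := (hex i).ge hx
    exact ⟨y, rfl⟩
  have hker (i : ℤ) : LinearMap.ker (π i) = LinearMap.ker (d i) := LinearMap.ker_codRestrict ..
  intro n
  induction n with
  | zero =>
    intro j
    obtain ⟨i, rfl⟩ : ∃ i : ℤ, j = i + 1 + 1 + 1 := ⟨j - 3, by ring⟩
    refine ModuleCat.subsingleton_ext_one_of_extends (π (i + 1 + 1)) (hπ _) _ ?_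
    rw [hker]
    intro φ
    obtain ⟨ψ, hψ⟩ := (hdual i (φ.comp (π (i + 1)))).1 <| by
      ext x
      have : π (i + 1) (d i x) = 0 := Subtype.ext ((hex i).le ⟨x, rfl⟩)
      simp [this]
    refine ⟨ψ, fun x => ?_⟩
    obtain ⟨y, rfl⟩ := hπ (i + 1) x
    exact LinearMap.congr_fun hψ y
  | succ n ih =>
    intro j
    obtain ⟨i, rfl⟩ : ∃ i : ℤ, j = i + 1 := ⟨j - 1, by ring⟩
    have : Projective (ModuleCat.of S (P i)) := (IsProjective.iff_projective _).1 (hproj i)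
    refine ModuleCat.subsingleton_ext_of_ker (π i) (hπ i) _ _
      (Abelian.Ext.subsingleton_of_projective _ _ _) ?_
    rw [hker]
    exact ih i

end IsGorensteinProjective

/-- If `X` has Gorenstein projective dimension at most `n`, then `Extⁱ(X, S) = 0` for `i > n`. -/
lemma HasGpdLE.subsingleton_ext {S : Type u} [Ring S] {X : Type u} [AddCommGroup X] [Module S X]
    {n : ℕ} (h : HasGpdLE S X n) (k : ℕ) :
    Subsingleton (Abelian.Ext (ModuleCat.of S X) (ModuleCat.of S S) (n + k + 1)) := by
  induction n generalizing X with
  | zero =>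
    obtain ⟨P, d, ε, hG, -, hε, h0, -, hsub⟩ := h
    have := hsub 1 one_pos
    have hinj : Function.Injective ε := by
      rw [← LinearMap.ker_eq_bot, h0, Subsingleton.elim (d 0) 0, LinearMap.range_zero]
    rw [zero_add]
    exact ((hG 0).of_linearEquiv (LinearEquiv.ofBijective ε ⟨hinj, hε⟩).symm).subsingleton_ext k
  | succ n ih =>
    obtain ⟨P, d, ε, hG, hfin, hε, h0, hex, hsub⟩ := h
    rw [show n + 1 + k + 1 = (n + k + 1) + 1 by ring]
    refine ModuleCat.subsingleton_ext_of_ker ε hε _ _ ((hG 0).subsingleton_ext _) (ih ?_)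
    refine ⟨fun i => P (i + 1), fun i => d (i + 1),
      (d 0).codRestrict _ fun x => h0.ge ⟨x, rfl⟩, fun i => hG _, fun i => hfin _, ?_, ?_,
      fun i => hex _, fun i hi => hsub _ (by lia)⟩
    · rintro ⟨x, hx⟩
      obtain ⟨y, rfl⟩ := h0.le hx
      exact ⟨y, rfl⟩
    · rw [LinearMap.ker_codRestrict]
      exact hex 0

/-- If every finitely generated module over a commutative noetherian ring `R` has
Gorenstein projective dimension at most `d`, then `Ext^i_R(X, R) = 0` for every finitely
generated `R`-module `X` and every `i > d`; in particular the self-injective dimension of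
`R` is at most `d`. -/
theorem stmt_11 (R : Type u) [CommRing R] [IsNoetherianRing R] (d : ℕ)
    (h : ∀ (X : Type u) [AddCommGroup X] [Module R X], Module.Finite R X →
      HasGpdLE R X d) :
    ∀ (X : Type u) [AddCommGroup X] [Module R X], Module.Finite R X →
      ∀ i : ℕ, d < i → ExtVanishes R X R i := by
  intro X _ _ hX i hi
  obtain ⟨k, rfl⟩ := Nat.exists_eq_add_of_lt hi
  have := (h X hX).subsingleton_ext k
  exact ModuleCat.subsingleton_of_isZero (isZero_Ext_of_subsingleton _ _ _)
end

section
/- Let R be a commutative noetherian ring, M a finitely generated nilpotent R-module, and T = T_R(M) its tensor ring. A finitely generated R-module Z is projective if and only if the left T-module T ⊗_R Z is projective. -/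
open CategoryTheory TensorProduct

universe u

/-- Projectivity descends along extension of scalars from `R` to an augmented `R`-algebra. -/
theorem Module.Projective.of_baseChange_of_augmentation {R A Z : Type*} [CommRing R] [Ring A]
    [Algebra R A] (ε : A →ₐ[R] R) [AddCommGroup Z] [Module R Z]
    [Module.Projective A (A ⊗[R] Z)] : Module.Projective R Z := by
  let π : (Z →₀ R) →ₗ[R] Z := Finsupp.linearCombination R id
  have hπ : Function.Surjective π := Finsupp.linearCombination_id_surjective R Z
  have hπA : Function.Surjective (π.baseChange A) := LinearMap.lTensor_surjective A hπ
  obtain ⟨s, hs⟩ := Module.projective_lifting_property (π.baseChange A) LinearMap.id hπA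
  let c : A ⊗[R] Z →ₗ[R] Z := (TensorProduct.lid R Z).toLinearMap ∘ₗ ε.toLinearMap.rTensor Z
  let c' : A ⊗[R] (Z →₀ R) →ₗ[R] (Z →₀ R) :=
    (TensorProduct.lid R _).toLinearMap ∘ₗ ε.toLinearMap.rTensor _
  have hc (x : A ⊗[R] (Z →₀ R)) : π (c' x) = c (π.baseChange A x) := by
    induction x with
    | zero => simp
    | add x y hx hy => simp only [map_add, hx, hy]
    | tmul a f => simp [c, c']
  refine Module.Projective.of_split
    (c' ∘ₗ s.restrictScalars R ∘ₗ TensorProduct.mk R A Z 1) π (LinearMap.ext fun z => ?_)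
  have hz : π.baseChange A (s (1 ⊗ₜ z)) = 1 ⊗ₜ z := LinearMap.congr_fun hs _
  simp [hc, hz, c]

/-- For a finitely generated nilpotent module `M` over a commutative noetherian ring `R`
with tensor ring `T = T_R(M)`, a finitely generated `R`-module `Z` is projective over `R`
if and only if `T ⊗_R Z` is projective over `T`. -/
theorem stmt_12 (R : Type u) [CommRing R] [IsNoetherianRing R]
    (M : Type u) [AddCommGroup M] [Module R M] [Module.Finite R M]
    (hnil : Module.IsNilpotentMod R M)
    (Z : Type u) [AddCommGroup Z] [Module R Z] [Module.Finite R Z] :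
    Module.Projective R Z ↔
      Module.Projective (TensorAlgebra R M) (TensorAlgebra R M ⊗[R] Z) := by
  exact ⟨fun _ => inferInstance, fun _ =>
    Module.Projective.of_baseChange_of_augmentation (TensorAlgebra.algebraMapInv (M := M))⟩
end

section
/- Let R be a commutative noetherian ring, Y a finitely generated R-module of finite projective dimension, and F^• an acyclic unbounded cochain complex of finitely generated R-modules such that Tor_i^R(Y, F^j) = 0 for all i ≥ 1 and all j ∈ ℤ. Then the complex Y ⊗_R F^• is acyclic. -/
open CategoryTheory TensorProduct

universe u

section DiagramChase

variable {R : Type*} [CommRing R]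
  {A₀ A₁ A₂ A₃ B₀ B₁ B₂ B₃ C₀ C₁ C₂ C₃ : Type*}
  [AddCommGroup A₀] [AddCommGroup A₁] [AddCommGroup A₂] [AddCommGroup A₃]
  [AddCommGroup B₀] [AddCommGroup B₁] [AddCommGroup B₂] [AddCommGroup B₃]
  [AddCommGroup C₀] [AddCommGroup C₁] [AddCommGroup C₂] [AddCommGroup C₃]
  [Module R A₀] [Module R A₁] [Module R A₂] [Module R A₃]
  [Module R B₀] [Module R B₁] [Module R B₂] [Module R B₃]
  [Module R C₀] [Module R C₁] [Module R C₂] [Module R C₃]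

/-- In a short exact sequence of complexes `A → B → C` (homological indexing), if `B` is exact in
degree `1` and `C` is exact in degree `2`, then `A` is exact in degree `1`. -/
theorem exact_left_of_exact_middle_of_exact_right
    {a₁ : A₂ →ₗ[R] A₁} {a₀ : A₁ →ₗ[R] A₀}
    {b₂ : B₃ →ₗ[R] B₂} {b₁ : B₂ →ₗ[R] B₁} {b₀ : B₁ →ₗ[R] B₀}
    {c₂ : C₃ →ₗ[R] C₂} {c₁ : C₂ →ₗ[R] C₁}
    {i₀ : A₀ →ₗ[R] B₀} {i₁ : A₁ →ₗ[R] B₁} {i₂ : A₂ →ₗ[R] B₂}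
    {p₁ : B₁ →ₗ[R] C₁} {p₂ : B₂ →ₗ[R] C₂} {p₃ : B₃ →ₗ[R] C₃}
    (ha : a₀ ∘ₗ a₁ = 0) (hb₂ : b₁ ∘ₗ b₂ = 0)
    (hb : Function.Exact b₁ b₀) (hc : Function.Exact c₂ c₁)
    (hi₀ : i₀ ∘ₗ a₀ = b₀ ∘ₗ i₁) (hi₁ : i₁ ∘ₗ a₁ = b₁ ∘ₗ i₂)
    (hp₁ : p₁ ∘ₗ b₁ = c₁ ∘ₗ p₂) (hp₂ : p₂ ∘ₗ b₂ = c₂ ∘ₗ p₃)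
    (inj : Function.Injective i₁) (hip₁ : Function.Exact i₁ p₁) (hip₂ : Function.Exact i₂ p₂)
    (surj : Function.Surjective p₃) : Function.Exact a₁ a₀ := by
  intro x
  refine ⟨fun hx => ?_, ?_⟩
  · obtain ⟨y, hy⟩ := (hb (i₁ x)).1 (by
      simpa [hx] using (LinearMap.congr_fun hi₀ x).symm)
    obtain ⟨z, hz⟩ := (hc (p₂ y)).1 (by
      have := LinearMap.congr_fun hp₁ y
      simp only [LinearMap.comp_apply, hy, hip₁.apply_apply_eq_zero] at this
      exact this.symm)
    obtain ⟨z', rfl⟩ := surj z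
    obtain ⟨w, hw⟩ := (hip₂ (y - b₂ z')).1 (by
      have := LinearMap.congr_fun hp₂ z'
      simp only [LinearMap.comp_apply] at this
      rw [map_sub, this, hz, sub_self])
    refine ⟨w, inj ?_⟩
    have h₁ := LinearMap.congr_fun hi₁ w
    have h₂ := LinearMap.congr_fun hb₂ z'
    simp only [LinearMap.comp_apply, LinearMap.zero_apply] at h₁ h₂
    rw [h₁, hw, map_sub, h₂, hy, sub_zero]
  · rintro ⟨w, rfl⟩
    exact LinearMap.congr_fun ha w

/-- In a short exact sequence of complexes `A → B → C` (cohomological indexing), if `B` is exact in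
degree `1` and `A` is exact in degree `2`, then `C` is exact in degree `1`. -/
theorem exact_right_of_exact_left_of_exact_middle
    {a₁ : A₁ →ₗ[R] A₂} {a₂ : A₂ →ₗ[R] A₃}
    {b₀ : B₀ →ₗ[R] B₁} {b₁ : B₁ →ₗ[R] B₂} {b₂ : B₂ →ₗ[R] B₃}
    {c₀ : C₀ →ₗ[R] C₁} {c₁ : C₁ →ₗ[R] C₂}
    {i₁ : A₁ →ₗ[R] B₁} {i₂ : A₂ →ₗ[R] B₂} {i₃ : A₃ →ₗ[R] B₃}
    {p₀ : B₀ →ₗ[R] C₀} {p₁ : B₁ →ₗ[R] C₁} {p₂ : B₂ →ₗ[R] C₂}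
    (hc : c₁ ∘ₗ c₀ = 0) (hb₂ : b₂ ∘ₗ b₁ = 0)
    (ha : Function.Exact a₁ a₂) (hb : Function.Exact b₀ b₁)
    (hi₁ : i₂ ∘ₗ a₁ = b₁ ∘ₗ i₁) (hi₂ : i₃ ∘ₗ a₂ = b₂ ∘ₗ i₂)
    (hp₀ : p₁ ∘ₗ b₀ = c₀ ∘ₗ p₀) (hp₁ : p₂ ∘ₗ b₁ = c₁ ∘ₗ p₁)
    (inj : Function.Injective i₃) (hip₁ : Function.Exact i₁ p₁) (hip₂ : Function.Exact i₂ p₂)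
    (surj : Function.Surjective p₁) : Function.Exact c₀ c₁ := by
  intro x
  refine ⟨fun hx => ?_, ?_⟩
  · obtain ⟨y, rfl⟩ := surj x
    obtain ⟨w, hw⟩ := (hip₂ (b₁ y)).1 ((LinearMap.congr_fun hp₁ y).trans hx)
    obtain ⟨v, rfl⟩ := (ha w).1 (inj (by
      have h₁ := LinearMap.congr_fun hi₂ w
      have h₂ := LinearMap.congr_fun hb₂ y
      simp only [LinearMap.comp_apply, LinearMap.zero_apply] at h₁ h₂
      rw [h₁, hw, h₂, map_zero]))
    obtain ⟨u, hu⟩ := (hb (y - i₁ v)).1 (by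
      have := LinearMap.congr_fun hi₁ v
      simp only [LinearMap.comp_apply] at this
      rw [map_sub, ← this, hw, sub_self])
    refine ⟨p₀ u, ?_⟩
    have := LinearMap.congr_fun hp₀ u
    simp only [LinearMap.comp_apply] at this
    rw [← this, hu, map_sub, hip₁.apply_apply_eq_zero, sub_zero]
  · rintro ⟨w, rfl⟩
    exact LinearMap.congr_fun hc w

end DiagramChase

section TorVanishing

variable {R : Type u} [CommRing R]

theorem CategoryTheory.ProjectiveResolution.flat_X {B : ModuleCat.{u} R} (P : ProjectiveResolution B) (i : ℕ) :
    Module.Flat R (P.complex.X i) := by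
  have : Module.Projective R (P.complex.X i) :=
    (IsProjective.iff_projective (R := R) (P.complex.X i)).2 (P.projective i)
  infer_instance

theorem CategoryTheory.ProjectiveResolution.function_exact {B : ModuleCat.{u} R} (P : ProjectiveResolution B)
    (i : ℕ) :
    Function.Exact (P.complex.d (i + 2) (i + 1)).hom (P.complex.d (i + 1) i).hom :=
  (ShortComplex.ShortExact.moduleCat_exact_iff_function_exact _).1 (P.exact_succ i)

/-- `Tor` can be computed by any projective resolution of the second argument. -/
theorem torVanishes_succ_iff (Y : Type u) [AddCommGroup Y] [Module R Y] {B : ModuleCat.{u} R}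
    (P : ProjectiveResolution B) (i : ℕ) :
    TorVanishes R Y B (i + 1) ↔
      Function.Exact (LinearMap.lTensor Y (P.complex.d (i + 2) (i + 1)).hom)
        (LinearMap.lTensor Y (P.complex.d (i + 1) i).hom) := by
  let F := (MonoidalCategory.tensoringLeft (ModuleCat.{u} R)).obj (ModuleCat.of R Y)
  have e := P.isoLeftDerivedObj F (i + 1)
  have h₁ : TorVanishes R Y B (i + 1) ↔
      Limits.IsZero (((F.mapHomologicalComplex _).obj P.complex).homology (i + 1)) :=
    (ModuleCat.isZero_iff_subsingleton (M := (F.leftDerived (i + 1)).obj B)).symm.trans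
      e.isZero_iff
  rw [h₁, ← HomologicalComplex.exactAt_iff_isZero_homology,
    HomologicalComplex.exactAt_iff' _ (i + 2) (i + 1) i (by simp only [ChainComplex.prev]; rfl)
      (by simp), ShortComplex.ShortExact.moduleCat_exact_iff_function_exact]
  rfl

/-- The augmentation of a projective resolution, as a linear map. -/
theorem CategoryTheory.ProjectiveResolution.exists_augmentation {B : ModuleCat.{u} R}
    (P : ProjectiveResolution B) :
    ∃ e : P.complex.X 0 →ₗ[R] B, Function.Surjective e ∧
      Function.Exact (P.complex.d 1 0).hom e :=
  ⟨(P.π.f 0).hom, (ModuleCat.epi_iff_surjective (P.π.f 0)).1 inferInstance,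
    (ShortComplex.ShortExact.moduleCat_exact_iff_function_exact _).1 P.exact₀⟩

theorem lTensor_comp_eq_zero (N : Type u) [AddCommGroup N] [Module R N]
    {A B C : Type u} [AddCommGroup A] [Module R A] [AddCommGroup B] [Module R B]
    [AddCommGroup C] [Module R C] {f : A →ₗ[R] B} {g : B →ₗ[R] C} (h : Function.Exact f g) :
    g.lTensor N ∘ₗ f.lTensor N = 0 := by
  rw [← LinearMap.lTensor_comp, h.linearMap_comp_eq_zero, LinearMap.lTensor_zero]

theorem rTensor_comp_lTensor_comm {A B C D : Type u} [AddCommGroup A] [Module R A]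
    [AddCommGroup B] [Module R B] [AddCommGroup C] [Module R C] [AddCommGroup D] [Module R D]
    (f : A →ₗ[R] B) (g : C →ₗ[R] D) :
    f.rTensor D ∘ₗ g.lTensor A = g.lTensor B ∘ₗ f.rTensor C := by
  rw [LinearMap.lTensor_comp_rTensor, LinearMap.rTensor_comp_lTensor]

variable {Q Y : Type u} [AddCommGroup Q] [Module R Q] [AddCommGroup Y] [Module R Y]
  [Module.Flat R Q] {ε : Q →ₗ[R] Y}

/-- Dimension shifting in the first argument of `Tor`. -/
theorem TorVanishes.ker (hε : Function.Surjective ε) {B : ModuleCat.{u} R} {i : ℕ}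
    (h : TorVanishes R Y B (i + 2)) : TorVanishes R (LinearMap.ker ε) B (i + 1) := by
  let P := projectiveResolution B
  have := P.flat_X
  rw [torVanishes_succ_iff _ P] at h ⊢
  have ex := LinearMap.exact_subtype_ker_map ε
  exact exact_left_of_exact_middle_of_exact_right
    (lTensor_comp_eq_zero _ (P.function_exact i)) (lTensor_comp_eq_zero _ (P.function_exact _))
    (Module.Flat.lTensor_exact Q (P.function_exact i)) h
    (rTensor_comp_lTensor_comm _ _) (rTensor_comp_lTensor_comm _ _)
    (rTensor_comp_lTensor_comm _ _) (rTensor_comp_lTensor_comm _ _)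
    (Module.Flat.rTensor_preserves_injective_linearMap (M := P.complex.X (i + 1))
      (LinearMap.ker ε).subtype (LinearMap.ker ε).injective_subtype)
    (rTensor_exact _ ex hε) (rTensor_exact _ ex hε) (LinearMap.rTensor_surjective _ hε)

theorem TorVanishes.rTensor_subtype_ker_injective (hε : Function.Surjective ε)
    {B : ModuleCat.{u} R} (h : TorVanishes R Y B 1) :
    Function.Injective ((LinearMap.ker ε).subtype.rTensor B) := by
  let P := projectiveResolution B
  have := P.flat_X
  obtain ⟨e, he, hde⟩ := P.exists_augmentation
  rw [torVanishes_succ_iff _ P] at h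
  have ex := LinearMap.exact_subtype_ker_map ε
  have key : Function.Exact ((P.complex.d 1 0).hom.lTensor (LinearMap.ker ε))
      ((LinearMap.ker ε).subtype.rTensor B ∘ₗ e.lTensor (LinearMap.ker ε)) :=
    exact_left_of_exact_middle_of_exact_right (i₀ := LinearMap.id)
      (by rw [LinearMap.comp_assoc, lTensor_comp_eq_zero _ hde, LinearMap.comp_zero])
      (lTensor_comp_eq_zero _ (P.function_exact 0))
      (Module.Flat.lTensor_exact Q hde) h
      ((LinearMap.id_comp _).trans (rTensor_comp_lTensor_comm _ _))
      (rTensor_comp_lTensor_comm _ _)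
      (rTensor_comp_lTensor_comm _ _) (rTensor_comp_lTensor_comm _ _)
      (Module.Flat.rTensor_preserves_injective_linearMap (M := P.complex.X 0)
        (LinearMap.ker ε).subtype (LinearMap.ker ε).injective_subtype)
      (rTensor_exact _ ex hε) (rTensor_exact _ ex hε) (LinearMap.rTensor_surjective _ hε)
  rw [injective_iff_map_eq_zero]
  intro x hx
  obtain ⟨y, rfl⟩ := LinearMap.lTensor_surjective (LinearMap.ker ε) he x
  obtain ⟨w, rfl⟩ := (key y).1 hx
  exact LinearMap.congr_fun (lTensor_comp_eq_zero _ hde) w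

end TorVanishing

section ProjectiveDimension

variable {R : Type u} [CommRing R] {Y : Type u} [AddCommGroup Y] [Module R Y]

theorem HasPdLE.projective (h : HasPdLE R Y 0) : Module.Projective R Y := by
  obtain ⟨P, d, ε, hproj, -, hε, hker, -, hzero⟩ := h
  have := hproj 0
  have := hzero 1 one_pos
  have hinj : LinearMap.ker ε = ⊥ := by
    rw [hker, Subsingleton.elim (d 0) 0, LinearMap.range_zero]
  exact Module.Projective.of_equiv
    (LinearEquiv.ofBijective ε ⟨LinearMap.ker_eq_bot.1 hinj, hε⟩)

theorem HasPdLE.exists_ker {n : ℕ} (h : HasPdLE R Y (n + 1)) :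
    ∃ (Q : ModuleCat.{u} R) (ε : Q →ₗ[R] Y), Module.Projective R Q ∧ Function.Surjective ε ∧
      HasPdLE R (LinearMap.ker ε) n := by
  obtain ⟨P, d, ε, hproj, hfin, hε, hker, hd, hzero⟩ := h
  have hmem : ∀ x, d 0 x ∈ LinearMap.ker ε := fun x => hker ▸ LinearMap.mem_range_self _ x
  refine ⟨P 0, ε, hproj 0, hε, fun i => P (i + 1), fun i => d (i + 1), (d 0).codRestrict _ hmem,
    fun i => hproj _, fun i => hfin _, ?_, ?_, fun i => hd _, fun i hi => hzero _ (by lia)⟩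
  · rintro ⟨x, hx⟩
    rw [hker] at hx
    obtain ⟨y, rfl⟩ := hx
    exact ⟨y, rfl⟩
  · rw [LinearMap.ker_codRestrict, hd]

/-- Tensoring with a module of finite projective dimension preserves exactness of an unbounded
complex of modules that are `Tor`-independent of it. -/
theorem HasPdLE.lTensor_exact {n : ℕ} (h : HasPdLE R Y n) {P : ℤ → ModuleCat.{u} R}
    {d : ∀ i : ℤ, P i →ₗ[R] P (i + 1)} (hd : ∀ i, Function.Exact (d i) (d (i + 1)))
    (hTor : ∀ (i : ℕ) (j : ℤ), 1 ≤ i → TorVanishes R Y (P j) i) (i : ℤ) :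
    Function.Exact ((d i).lTensor Y) ((d (i + 1)).lTensor Y) := by
  induction n generalizing Y i with
  | zero =>
    have := h.projective
    exact Module.Flat.lTensor_exact Y (hd i)
  | succ n ih =>
    obtain ⟨Q, ε, hQ, hε, hK⟩ := h.exists_ker
    have ex := LinearMap.exact_subtype_ker_map ε
    have hK' := ih hK fun i j hi => by
      obtain ⟨k, rfl⟩ := Nat.exists_eq_add_of_le' hi
      exact (hTor (k + 2) j (by lia)).ker hε
    exact exact_right_of_exact_left_of_exact_middle
      (lTensor_comp_eq_zero _ (hd i)) (lTensor_comp_eq_zero _ (hd _))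
      (hK' (i + 1)) (Module.Flat.lTensor_exact Q (hd i))
      (rTensor_comp_lTensor_comm _ _) (rTensor_comp_lTensor_comm _ _)
      (rTensor_comp_lTensor_comm _ _) (rTensor_comp_lTensor_comm _ _)
      ((hTor 1 _ le_rfl).rTensor_subtype_ker_injective hε)
      (rTensor_exact _ ex hε) (rTensor_exact _ ex hε) (LinearMap.rTensor_surjective _ hε)

end ProjectiveDimension

/-- Let `R` be a commutative noetherian ring, `Y` a finitely generated `R`-module of
finite projective dimension, and `F^•` an acyclic unbounded cochain complex of finitely
generated `R`-modules with `Tor_i^R(Y, F^j) = 0` for all `i ≥ 1` and all `j`. Then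
`Y ⊗_R F^•` is acyclic. -/
theorem stmt_17 (R : Type u) [CommRing R] [IsNoetherianRing R]
    (Y : Type u) [AddCommGroup Y] [Module R Y] [Module.Finite R Y]
    (hY : ∃ n : ℕ, HasPdLE R Y n)
    (P : ℤ → ModuleCat.{u} R) (d : ∀ i : ℤ, P i →ₗ[R] P (i + 1))
    (hfg : ∀ i, Module.Finite R (P i))
    (hacyclic : ∀ i, LinearMap.range (d i) = LinearMap.ker (d (i + 1)))
    (hTor : ∀ (i : ℕ) (j : ℤ), 1 ≤ i → TorVanishes R Y (P j) i) :
    ∀ i : ℤ, LinearMap.range (LinearMap.lTensor Y (d i)) =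
      LinearMap.ker (LinearMap.lTensor Y (d (i + 1))) := by
  intro i
  obtain ⟨n, hn⟩ := hY
  exact (hn.lTensor_exact (fun j => LinearMap.exact_iff.2 (hacyclic j).symm)
    hTor i).linearMap_ker_eq.symm
end

section
/- Let R be a commutative noetherian ring and M a finitely generated R-module satisfying Tor_i^R(M, M^{⊗_R j}) = 0 for all i, j ≥ 1. Then for every finitely generated R-module Y the following are equivalent: (1) Tor_i^R(M, M^{⊗_R j} ⊗_R Y) = 0 for all i ≥ 1 and j ≥ 0; (2) Tor_i^R(M^{⊗_R s}, M^{⊗_R j} ⊗_R Y) = 0 for all i, s ≥ 1 and j ≥ 0; (3) Tor_i^R(M^{⊗_R s}, Y) = 0 for all i, s ≥ 1. -/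
open CategoryTheory TensorProduct

universe u

namespace CategoryTheory.ProjectiveResolution

open Limits

variable {C : Type*} [Category* C] [Abelian C]

/-- The augmentation `Q₀ ⟶ K` of a projective resolution of `K`. -/
def augmentation {K : C} (Q : ProjectiveResolution K) : Q.complex.X 0 ⟶ K := Q.π.f 0

instance {K : C} (Q : ProjectiveResolution K) : Epi Q.augmentation :=
  inferInstanceAs (Epi (Q.π.f 0))

lemma d_comp_augmentation {K : C} (Q : ProjectiveResolution K) :
    Q.complex.d 1 0 ≫ Q.augmentation = 0 :=
  Q.complex_d_comp_π_f_zero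

lemma exact_d_augmentation {K : C} (Q : ProjectiveResolution K) :
    (ShortComplex.mk (Q.complex.d 1 0) Q.augmentation Q.d_comp_augmentation).Exact :=
  Q.exact₀

lemma d_comp_augmentation_comp {K P : C} (Q : ProjectiveResolution K) (f : K ⟶ P) :
    Q.complex.d 1 0 ≫ Q.augmentation ≫ f = 0 := by
  rw [← Category.assoc, Q.d_comp_augmentation, zero_comp]

/-- Splicing a projective resolution of `K` with a monomorphism `K ⟶ P` gives a complex that is
exact in positive degrees. -/
lemma augment_exactAt_succ {K P : C} (Q : ProjectiveResolution K) (f : K ⟶ P) [Mono f] (n : ℕ) :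
    (ChainComplex.augment Q.complex (Q.augmentation ≫ f)
      (Q.d_comp_augmentation_comp f)).ExactAt (n + 1) := by
  rw [HomologicalComplex.exactAt_iff' _ (n + 1 + 1) (n + 1) n (by simp) (by simp)]
  match n with
  | 0 =>
    let φ : ShortComplex.mk _ _ Q.d_comp_augmentation ⟶
        ShortComplex.mk _ _ (Q.d_comp_augmentation_comp f) := { τ₁ := 𝟙 _, τ₂ := 𝟙 _, τ₃ := f }
    have : Epi φ.τ₁ := inferInstanceAs (Epi (𝟙 _))
    have : IsIso φ.τ₂ := inferInstanceAs (IsIso (𝟙 _))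
    have : Mono φ.τ₃ := inferInstanceAs (Mono f)
    exact (ShortComplex.exact_iff_of_epi_of_isIso_of_mono φ).1 Q.exact_d_augmentation
  | n + 1 => exact Q.exact_succ n

/-- A projective resolution of `N` obtained from a short exact sequence `0 ⟶ K ⟶ P ⟶ N ⟶ 0`
with `P` projective and a projective resolution of `K`. -/
noncomputable def ofShortExact {S : ShortComplex C} (hS : S.ShortExact) [Projective S.X₂]
    (Q : ProjectiveResolution S.X₁) : ProjectiveResolution S.X₃ where
  complex := ChainComplex.augment Q.complex (Q.augmentation ≫ S.f) (Q.d_comp_augmentation_comp _)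
  projective
    | 0 => (inferInstance : Projective S.X₂)
    | n + 1 => Q.projective n
  π := (ChainComplex.toSingle₀Equiv _ _).symm ⟨S.g, by
    change (Q.augmentation ≫ S.f) ≫ S.g = 0
    rw [Category.assoc, S.zero, comp_zero]⟩
  quasiIso := ⟨fun n => by
    have := hS.mono_f
    have := hS.epi_g
    cases n
    · rw [ChainComplex.quasiIsoAt₀_iff, ShortComplex.quasiIso_iff_of_zeros']
      · let T := ShortComplex.mk (Q.augmentation ≫ S.f) S.g (by simp)
        let φ : T ⟶ S := { τ₁ := Q.augmentation, τ₂ := 𝟙 _, τ₃ := 𝟙 _ }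
        have : Epi φ.τ₁ := inferInstanceAs (Epi Q.augmentation)
        have : IsIso φ.τ₂ := inferInstanceAs (IsIso (𝟙 _))
        have : Mono φ.τ₃ := inferInstanceAs (Mono (𝟙 _))
        have hT : T.Exact := (ShortComplex.exact_iff_of_epi_of_isIso_of_mono φ).2 hS.exact
        refine (ShortComplex.exact_and_epi_g_iff_of_iso ?_).2 ⟨hT, hS.epi_g⟩
        refine ShortComplex.isoMk (Iso.refl _) (Iso.refl _) (Iso.refl _) ?_ ?_
        · erw [Category.id_comp, Category.comp_id]; rfl
        · erw [Category.id_comp, Category.comp_id]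
          exact (ChainComplex.toSingle₀Equiv_symm_apply_f_zero (V := C)
            (C := ChainComplex.augment Q.complex (Q.augmentation ≫ S.f) _) S.g _).symm
      all_goals rfl
    · rw [quasiIsoAt_iff_exactAt']
      · exact Q.augment_exactAt_succ S.f _
      · apply ChainComplex.exactAt_succ_single_obj⟩

end CategoryTheory.ProjectiveResolution

section Tor

variable {R : Type u} [CommRing R]

open Function

lemma torVanishes_succ_iff_exact (A : Type u) [AddCommGroup A] [Module R A] {N : ModuleCat.{u} R}
    (Q : ProjectiveResolution N) (n : ℕ) :
    TorVanishes R A N (n + 1) ↔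
      Exact ((Q.complex.d (n + 2) (n + 1)).hom.lTensor A)
        ((Q.complex.d (n + 1) n).hom.lTensor A) := by
  have e := Q.isoLeftDerivedObj ((MonoidalCategory.tensoringLeft _).obj (ModuleCat.of R A)) (n + 1)
  rw [TorVanishes]
  refine (ModuleCat.isZero_iff_subsingleton).symm.trans ?_
  refine e.isZero_iff.trans ?_
  erw [← HomologicalComplex.exactAt_iff_isZero_homology]
  rw [HomologicalComplex.exactAt_iff' _ (n + 1 + 1) (n + 1) n (by simp) (by simp)]
  rw [ShortComplex.ShortExact.moduleCat_exact_iff_function_exact]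
  exact Iff.rfl

/-- `Tor_i^R(A, N) = 0` for `1 ≤ i ≤ n`. -/
def TorAcyclic (R : Type u) [CommRing R] (A N : Type u) [AddCommGroup A] [Module R A]
    [AddCommGroup N] [Module R N] (n : ℕ) : Prop :=
  ∀ i, 1 ≤ i → i ≤ n → TorVanishes R A N i

variable {A B : Type u} [AddCommGroup A] [Module R A] [AddCommGroup B] [Module R B]
  {K F N : Type u} [AddCommGroup K] [Module R K] [AddCommGroup F] [Module R F]
  [AddCommGroup N] [Module R N]

lemma TorVanishes.congr (e₁ : A ≃ₗ[R] B) (e₂ : K ≃ₗ[R] N) {i : ℕ} (h : TorVanishes R A K i) :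
    TorVanishes R B N i := by
  let φ := ((Tor (ModuleCat.{u} R) i).mapIso e₁.toModuleIso).app (ModuleCat.of R K) ≪≫
    ((Tor (ModuleCat.{u} R) i).obj (ModuleCat.of R B)).mapIso e₂.toModuleIso
  have : Subsingleton (((Tor (ModuleCat.{u} R) i).obj (ModuleCat.of R A)).obj
    (ModuleCat.of R K)) := h
  exact φ.toLinearEquiv.symm.toEquiv.subsingleton

lemma TorAcyclic.mono {m n : ℕ} (h : TorAcyclic R A N n) (hmn : m ≤ n) : TorAcyclic R A N m :=
  fun i h₁ h₂ => h i h₁ (h₂.trans hmn)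

lemma torAcyclic_zero : TorAcyclic R A N 0 := fun i h₁ h₂ => by omega

section Projective

variable [Module.Projective R F] {f : K →ₗ[R] F} {g : F →ₗ[R] N}

/-- The dimension shift along `0 ⟶ K ⟶ F ⟶ N ⟶ 0` with `F` projective. -/
lemma torAcyclic_succ_iff (hf : Injective f) (hfg : Exact f g) (hg : Surjective g) (n : ℕ) :
    TorAcyclic R A N (n + 1) ↔ Injective (f.lTensor A) ∧ TorAcyclic R A K n := by
  let S : ShortComplex (ModuleCat.{u} R) := ShortComplex.mk (ModuleCat.ofHom f) (ModuleCat.ofHom g)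
    (by ext x; exact hfg.apply_apply_eq_zero x)
  have hS : S.ShortExact :=
    { exact := (ShortComplex.ShortExact.moduleCat_exact_iff_function_exact S).2 hfg
      mono_f := (ModuleCat.mono_iff_injective _).2 hf
      epi_g := (ModuleCat.epi_iff_surjective _).2 hg }
  have : Projective S.X₂ := (IsProjective.iff_projective (R := R) F).1 inferInstance
  let Q : ProjectiveResolution S.X₁ := projectiveResolution S.X₁
  let Q' := ProjectiveResolution.ofShortExact hS Q
  have hsucc (i : ℕ) : TorVanishes R A N (i + 2) ↔ TorVanishes R A K (i + 1) :=
    (torVanishes_succ_iff_exact A Q' (i + 1)).trans (torVanishes_succ_iff_exact A Q i).symm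
  have hone : TorVanishes R A N 1 ↔ Injective (f.lTensor A) := by
    refine (torVanishes_succ_iff_exact A Q' 0).trans ?_
    change Exact ((Q.complex.d 1 0).hom.lTensor A) ((f ∘ₗ Q.augmentation.hom).lTensor A) ↔ _
    have hsurj : Surjective Q.augmentation.hom :=
      (ModuleCat.epi_iff_surjective Q.augmentation).1 inferInstance
    have hex := lTensor_exact A
      ((ShortComplex.ShortExact.moduleCat_exact_iff_function_exact _).1 Q.exact_d_augmentation)
      hsurj
    have hsurj' := LinearMap.lTensor_surjective A hsurj
    rw [LinearMap.lTensor_comp]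
    constructor
    · intro h
      rw [injective_iff_map_eq_zero]
      intro x hx
      obtain ⟨y, rfl⟩ := hsurj' x
      exact (hex y).2 ((h y).1 hx)
    · intro h y
      rw [← hex y, LinearMap.comp_apply, map_eq_zero_iff _ h]
  constructor
  · intro h
    refine ⟨hone.1 (h 1 le_rfl (by omega)), fun i h₁ h₂ => ?_⟩
    obtain ⟨i, rfl⟩ := Nat.exists_eq_succ_of_ne_zero (by omega : i ≠ 0)
    exact (hsucc i).1 (h _ (by omega) (by omega))
  · rintro ⟨hinj, h⟩ i h₁ h₂
    match i with
    | 1 => exact hone.2 hinj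
    | i + 2 => exact (hsucc i).2 (h _ (by omega) (by omega))

end Projective

lemma exists_projective_surjective (R : Type u) [CommRing R] (X : Type u) [AddCommGroup X]
    [Module R X] : ∃ (P : Type u) (_ : AddCommGroup P) (_ : Module R P)
      (_ : Module.Projective R P) (p : P →ₗ[R] X), Surjective p :=
  ⟨X →₀ R, inferInstance, inferInstance, inferInstance, Finsupp.linearCombination R id,
    Finsupp.linearCombination_id_surjective R X⟩

lemma torAcyclic_succ_iff_ker {P : Type u} [AddCommGroup P] [Module R P] [Module.Projective R P]
    {g : P →ₗ[R] N} (hg : Surjective g) (n : ℕ) :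
    TorAcyclic R A N (n + 1) ↔
      Injective ((LinearMap.ker g).subtype.lTensor A) ∧ TorAcyclic R A (LinearMap.ker g) n :=
  torAcyclic_succ_iff (Submodule.subtype_injective _) g.exact_subtype_ker_map hg n

section ShortExact

variable {f : K →ₗ[R] F} {g : F →ₗ[R] N} {P P' : Type u} [AddCommGroup P] [Module R P]
  [AddCommGroup P'] [Module R P']

/-- For a map `p : P → F`, the map from the kernel of `P → F → N` to the kernel `K` of
`F → N`. -/
noncomputable def kerCompToKer (hf : Injective f) (hfg : Exact f g) (p : P →ₗ[R] F) :
    LinearMap.ker (g ∘ₗ p) →ₗ[R] K :=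
  LinearMap.codRestrictOfInjective (p ∘ₗ (LinearMap.ker (g ∘ₗ p)).subtype) f hf
    fun x => (hfg _).1 x.2

lemma comp_kerCompToKer (hf : Injective f) (hfg : Exact f g) (p : P →ₗ[R] F) :
    f ∘ₗ kerCompToKer hf hfg p = p ∘ₗ (LinearMap.ker (g ∘ₗ p)).subtype :=
  LinearMap.codRestrictOfInjective_comp _ _ _ _

lemma apply_kerCompToKer (hf : Injective f) (hfg : Exact f g) (p : P →ₗ[R] F)
    (x : LinearMap.ker (g ∘ₗ p)) : f (kerCompToKer hf hfg p x) = p x :=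
  LinearMap.congr_fun (comp_kerCompToKer hf hfg p) x

lemma kerCompToKer_surjective (hf : Injective f) (hfg : Exact f g) {p : P →ₗ[R] F}
    (hp : Surjective p) : Surjective (kerCompToKer hf hfg p) := by
  intro k
  obtain ⟨x, hx⟩ := hp (f k)
  refine ⟨⟨x, ?_⟩, hf ?_⟩
  · rw [LinearMap.mem_ker, LinearMap.comp_apply, hx, hfg.apply_apply_eq_zero]
  · rw [apply_kerCompToKer, hx]

lemma exact_inclusion_kerCompToKer (hf : Injective f) (hfg : Exact f g) (p : P →ₗ[R] F) :
    Exact (Submodule.inclusion (LinearMap.ker_le_ker_comp p g)) (kerCompToKer hf hfg p) := by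
  intro x
  rw [← map_eq_zero_iff f hf, apply_kerCompToKer]
  constructor
  · intro h
    exact ⟨⟨x, h⟩, rfl⟩
  · rintro ⟨y, rfl⟩
    exact y.2

/-- If `Tor_1^R(A, N) = 0`, then `A ⊗ -` preserves injectivity of any `K → F` with
cokernel `N`. -/
lemma TorAcyclic.lTensor_injective (h : TorAcyclic R A N 1) (hf : Injective f) (hfg : Exact f g)
    (hg : Surjective g) : Injective (f.lTensor A) := by
  obtain ⟨P, _, _, _, p, hp⟩ := exists_projective_surjective R F
  have hinj := ((torAcyclic_succ_iff_ker (g := g ∘ₗ p) (hg.comp hp) 0).1 h).1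
  rw [injective_iff_map_eq_zero]
  intro x hx
  obtain ⟨y, rfl⟩ := LinearMap.lTensor_surjective A (kerCompToKer_surjective hf hfg hp) x
  rw [← LinearMap.comp_apply, ← LinearMap.lTensor_comp, comp_kerCompToKer,
    LinearMap.lTensor_comp, LinearMap.comp_apply] at hx
  obtain ⟨z, hz⟩ := (lTensor_exact A p.exact_subtype_ker_map hp _).1 hx
  rw [lTensor_exact A (exact_inclusion_kerCompToKer hf hfg p) (kerCompToKer_surjective hf hfg hp) y]
  refine ⟨z, hinj ?_⟩
  rw [← hz, ← LinearMap.comp_apply, ← LinearMap.lTensor_comp]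
  rfl

/-- The inclusion of syzygies in the horseshoe diagram. -/
def horseshoeInl (f : K →ₗ[R] F) (a : P →ₗ[R] K) (b : P' →ₗ[R] F) :
    LinearMap.ker a →ₗ[R] LinearMap.ker ((f ∘ₗ a).coprod b) :=
  (LinearMap.inl R P P').restrict fun x hx => by
    rw [LinearMap.mem_ker] at hx ⊢
    simp [hx]

/-- The projection of syzygies in the horseshoe diagram. -/
def horseshoeSnd (hfg : Exact f g) (a : P →ₗ[R] K) (b : P' →ₗ[R] F) :
    LinearMap.ker ((f ∘ₗ a).coprod b) →ₗ[R] LinearMap.ker (g ∘ₗ b) :=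
  (LinearMap.snd R P P').restrict fun x hx => by
    rw [LinearMap.mem_ker] at hx ⊢
    have := congrArg g hx
    simpa [hfg.apply_apply_eq_zero] using this

lemma horseshoeInl_injective (f : K →ₗ[R] F) (a : P →ₗ[R] K) (b : P' →ₗ[R] F) :
    Injective (horseshoeInl f a b) := by
  intro x y h
  exact Subtype.ext (congrArg (fun z => z.1.1) h)

lemma horseshoe_exact (hf : Injective f) (hfg : Exact f g) (a : P →ₗ[R] K) (b : P' →ₗ[R] F) :
    Exact (horseshoeInl f a b) (horseshoeSnd hfg a b) := by
  rintro ⟨⟨x, y⟩, hxy⟩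
  constructor
  · intro h
    obtain rfl : y = 0 := congrArg Subtype.val h
    refine ⟨⟨x, hf ?_⟩, rfl⟩
    simpa using hxy
  · rintro ⟨z, hz⟩
    rw [← hz]
    rfl

lemma horseshoeSnd_surjective (hfg : Exact f g) {a : P →ₗ[R] K} (ha : Surjective a)
    (b : P' →ₗ[R] F) : Surjective (horseshoeSnd hfg a b) := by
  rintro ⟨y, hy⟩
  obtain ⟨k, hk⟩ := (hfg (b y)).1 hy
  obtain ⟨x, rfl⟩ := ha k
  exact ⟨⟨(-x, y), by simp [hk]⟩, rfl⟩

lemma horseshoe_surjective (hfg : Exact f g) {a : P →ₗ[R] K} (ha : Surjective a)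
    {b : P' →ₗ[R] F} (hb : Surjective (g ∘ₗ b)) : Surjective ((f ∘ₗ a).coprod b) := by
  intro y
  obtain ⟨x, hx⟩ := hb (g y)
  obtain ⟨k, hk⟩ := (hfg (y - b x)).1 (by rw [map_sub, sub_eq_zero]; exact hx.symm)
  obtain ⟨z, rfl⟩ := ha k
  exact ⟨(z, x), by simp [hk]⟩

lemma lTensor_inl_injective : Injective ((LinearMap.inl R P P').lTensor A) := by
  refine LeftInverse.injective (g := (LinearMap.fst R P P').lTensor A) fun x => ?_
  rw [← LinearMap.comp_apply, ← LinearMap.lTensor_comp, LinearMap.fst_comp_inl,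
    LinearMap.lTensor_id, LinearMap.id_apply]

lemma lTensor_comp_horseshoeInl (f : K →ₗ[R] F) (a : P →ₗ[R] K) (b : P' →ₗ[R] F) :
    (LinearMap.ker ((f ∘ₗ a).coprod b)).subtype.lTensor A ∘ₗ (horseshoeInl f a b).lTensor A =
      (LinearMap.inl R P P').lTensor A ∘ₗ (LinearMap.ker a).subtype.lTensor A := by
  rw [← LinearMap.lTensor_comp, ← LinearMap.lTensor_comp]
  rfl

lemma lTensor_comp_horseshoeSnd (hfg : Exact f g) (a : P →ₗ[R] K) (b : P' →ₗ[R] F) :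
    (LinearMap.ker (g ∘ₗ b)).subtype.lTensor A ∘ₗ (horseshoeSnd hfg a b).lTensor A =
      (LinearMap.snd R P P').lTensor A ∘ₗ
        (LinearMap.ker ((f ∘ₗ a).coprod b)).subtype.lTensor A := by
  rw [← LinearMap.lTensor_comp, ← LinearMap.lTensor_comp]
  rfl

end ShortExact

lemma TorAcyclic.extension {n : ℕ} {K F N : Type u} [AddCommGroup K] [Module R K]
    [AddCommGroup F] [Module R F] [AddCommGroup N] [Module R N] {f : K →ₗ[R] F} {g : F →ₗ[R] N}
    (hf : Injective f) (hfg : Exact f g) (hg : Surjective g)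
    (hK : TorAcyclic R A K n) (hN : TorAcyclic R A N n) : TorAcyclic R A F n := by
  induction n generalizing K F N with
  | zero => exact torAcyclic_zero
  | succ n ih =>
    obtain ⟨P, _, _, _, a, ha⟩ := exists_projective_surjective R K
    obtain ⟨P', _, _, _, b, hb'⟩ := exists_projective_surjective R F
    have hb : Surjective (g ∘ₗ b) := hg.comp hb'
    rw [torAcyclic_succ_iff_ker ha] at hK
    rw [torAcyclic_succ_iff_ker hb] at hN
    rw [torAcyclic_succ_iff_ker (horseshoe_surjective hfg ha hb)]
    refine ⟨?_, ih (horseshoeInl_injective f a b) (horseshoe_exact hf hfg a b)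
      (horseshoeSnd_surjective hfg ha b) hK.2 hN.2⟩
    rw [injective_iff_map_eq_zero]
    intro w hw
    have hw' : (horseshoeSnd hfg a b).lTensor A w = 0 := by
      apply hN.1
      rw [← LinearMap.comp_apply, lTensor_comp_horseshoeSnd, LinearMap.comp_apply, hw, map_zero,
        map_zero]
    obtain ⟨z, rfl⟩ := (lTensor_exact A (horseshoe_exact hf hfg a b)
      (horseshoeSnd_surjective hfg ha b) w).1 hw'
    rw [← LinearMap.comp_apply, lTensor_comp_horseshoeInl, LinearMap.comp_apply,
      map_eq_zero_iff _ lTensor_inl_injective, map_eq_zero_iff _ hK.1] at hw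
    rw [hw, map_zero]

lemma TorAcyclic.of_middle_of_right {n : ℕ} {K F N : Type u} [AddCommGroup K] [Module R K]
    [AddCommGroup F] [Module R F] [AddCommGroup N] [Module R N] {f : K →ₗ[R] F} {g : F →ₗ[R] N}
    (hf : Injective f) (hfg : Exact f g) (hg : Surjective g)
    (hF : TorAcyclic R A F n) (hN : TorAcyclic R A N (n + 1)) : TorAcyclic R A K n := by
  induction n generalizing K F N with
  | zero => exact torAcyclic_zero
  | succ n ih =>
    obtain ⟨P, _, _, _, a, ha⟩ := exists_projective_surjective R K
    obtain ⟨P', _, _, _, b, hb'⟩ := exists_projective_surjective R F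
    have hb : Surjective (g ∘ₗ b) := hg.comp hb'
    rw [torAcyclic_succ_iff_ker (horseshoe_surjective hfg ha hb)] at hF
    rw [torAcyclic_succ_iff_ker hb] at hN
    rw [torAcyclic_succ_iff_ker ha]
    refine ⟨?_, ih (horseshoeInl_injective f a b) (horseshoe_exact hf hfg a b)
      (horseshoeSnd_surjective hfg ha b) hF.2 hN.2⟩
    have hinj := (hN.2.mono (by omega)).lTensor_injective (horseshoeInl_injective f a b)
      (horseshoe_exact hf hfg a b) (horseshoeSnd_surjective hfg ha b)
    have hcomp := hF.1.comp hinj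
    rw [← LinearMap.coe_comp, lTensor_comp_horseshoeInl, LinearMap.coe_comp] at hcomp
    exact hcomp.of_comp

lemma TorAcyclic.of_left_of_middle {n : ℕ} {f : K →ₗ[R] F} {g : F →ₗ[R] N}
    (hf : Injective f) (hfg : Exact f g) (hg : Surjective g) (hinj : Injective (f.lTensor A))
    (hK : TorAcyclic R A K n) (hF : TorAcyclic R A F (n + 1)) : TorAcyclic R A N (n + 1) := by
  obtain ⟨P, _, _, _, p, hp⟩ := exists_projective_surjective R F
  rw [torAcyclic_succ_iff_ker hp] at hF
  rw [torAcyclic_succ_iff_ker (g := g ∘ₗ p) (hg.comp hp)]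
  have hex := exact_inclusion_kerCompToKer hf hfg p
  have hsurj := kerCompToKer_surjective hf hfg hp
  refine ⟨?_, TorAcyclic.extension (Submodule.inclusion_injective _) hex hsurj hF.2 hK⟩
  rw [injective_iff_map_eq_zero]
  intro w hw
  have hw' : (kerCompToKer hf hfg p).lTensor A w = 0 := by
    apply hinj
    rw [← LinearMap.comp_apply, ← LinearMap.lTensor_comp, comp_kerCompToKer,
      LinearMap.lTensor_comp, LinearMap.comp_apply, hw, map_zero, map_zero]
  obtain ⟨z, rfl⟩ := (lTensor_exact A hex hsurj w).1 hw'
  rw [← LinearMap.comp_apply, ← LinearMap.lTensor_comp] at hw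
  rw [(map_eq_zero_iff _ hF.1).1 hw, map_zero]

/-- `(A ⊗ B) ⊗ f` is injective if and only if `A ⊗ (B ⊗ f)` is. -/
lemma lTensor_tensor_injective_iff {f : K →ₗ[R] F} :
    Injective (f.lTensor (A ⊗[R] B)) ↔ Injective ((f.lTensor B).lTensor A) := by
  rw [LinearMap.lTensor_tensor]
  simp

/-- `A ⊗ (f ⊗ P)` is injective if `A ⊗ f` is and `P` is flat. -/
lemma lTensor_rTensor_injective {f : K →ₗ[R] F} (hf : Injective (f.lTensor A))
    (P : Type u) [AddCommGroup P] [Module R P] [Module.Flat R P] :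
    Injective ((f.rTensor P).lTensor A) := by
  have h := Module.Flat.rTensor_preserves_injective_linearMap (M := P) (f.lTensor A) hf
  have hcomp : (f.rTensor P).lTensor A = (TensorProduct.assoc R A F P).toLinearMap ∘ₗ
      (f.lTensor A).rTensor P ∘ₗ (TensorProduct.assoc R A K P).symm.toLinearMap := by
    ext
    rfl
  rw [hcomp]
  simpa using h

lemma TorAcyclic.tensor_projective {n : ℕ} {B : Type u} [AddCommGroup B] [Module R B]
    (h : TorAcyclic R A B n) (P : Type u) [AddCommGroup P] [Module R P] [Module.Projective R P] :
    TorAcyclic R A (B ⊗[R] P) n := by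
  induction n generalizing B with
  | zero => exact torAcyclic_zero
  | succ n ih =>
    obtain ⟨Q, _, _, _, p, hp⟩ := exists_projective_surjective R B
    rw [torAcyclic_succ_iff_ker hp] at h
    rw [torAcyclic_succ_iff (Module.Flat.rTensor_preserves_injective_linearMap (M := P) _
      (Submodule.subtype_injective _)) (rTensor_exact P p.exact_subtype_ker_map hp)
      (LinearMap.rTensor_surjective P hp)]
    exact ⟨lTensor_rTensor_injective h.1 P, ih h.2⟩

/-- If `Tor_i^R(A, B) = 0 = Tor_i^R(B, Y)` for all `i ≥ 1`, then vanishing of all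
`Tor_i^R(A ⊗ B, Y)` implies vanishing of all `Tor_i^R(A, B ⊗ Y)`. -/
lemma TorAcyclic.tensor_right (hAB : ∀ n, TorAcyclic R A B n) {Y : Type u} [AddCommGroup Y]
    [Module R Y] (hBY : ∀ n, TorAcyclic R B Y n) {n : ℕ} (h : TorAcyclic R (A ⊗[R] B) Y n) :
    TorAcyclic R A (B ⊗[R] Y) n := by
  induction n generalizing Y with
  | zero => exact torAcyclic_zero
  | succ n ih =>
    obtain ⟨P, _, _, _, p, hp⟩ := exists_projective_surjective R Y
    have hB (m : ℕ) := (torAcyclic_succ_iff_ker hp m).1 (hBY (m + 1))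
    rw [torAcyclic_succ_iff_ker hp] at h
    exact TorAcyclic.of_left_of_middle (hB 0).1 (lTensor_exact B p.exact_subtype_ker_map hp)
      (LinearMap.lTensor_surjective B hp) (lTensor_tensor_injective_iff.1 h.1)
      (ih (fun m => (hB m).2) h.2) ((hAB _).tensor_projective _)

/-- If `Tor_i^R(A, B) = 0 = Tor_i^R(B, Y)` for all `i ≥ 1`, then vanishing of all
`Tor_i^R(A, B ⊗ Y)` implies vanishing of all `Tor_i^R(A ⊗ B, Y)`. -/
lemma TorAcyclic.tensor_left (hAB : ∀ n, TorAcyclic R A B n) {Y : Type u} [AddCommGroup Y]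
    [Module R Y] (hBY : ∀ n, TorAcyclic R B Y n) {n : ℕ} (h : TorAcyclic R A (B ⊗[R] Y) n) :
    TorAcyclic R (A ⊗[R] B) Y n := by
  induction n generalizing Y with
  | zero => exact torAcyclic_zero
  | succ n ih =>
    obtain ⟨P, _, _, _, p, hp⟩ := exists_projective_surjective R Y
    have hB (m : ℕ) := (torAcyclic_succ_iff_ker hp m).1 (hBY (m + 1))
    have hex := lTensor_exact B p.exact_subtype_ker_map hp
    have hsurj := LinearMap.lTensor_surjective B hp
    rw [torAcyclic_succ_iff_ker hp]
    exact ⟨lTensor_tensor_injective_iff.2 ((h.mono (by omega)).lTensor_injective (hB 0).1 hex hsurj),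
      ih (fun m => (hB m).2) (TorAcyclic.of_middle_of_right (hB 0).1 hex hsurj
        ((hAB _).tensor_projective _) h)⟩

lemma forall_torAcyclic_iff :
    (∀ n, TorAcyclic R A N n) ↔ ∀ i, 1 ≤ i → TorVanishes R A N i :=
  ⟨fun h i hi => h i i hi le_rfl, fun h _ i hi _ => h i hi⟩

/-- If `Tor_i^R(A, B) = 0 = Tor_i^R(B, Y)` for all `i ≥ 1`, then all `Tor_i^R(A ⊗ B, Y)` with
`i ≥ 1` vanish if and only if all `Tor_i^R(A, B ⊗ Y)` with `i ≥ 1` do. -/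
lemma forall_torVanishes_tensor_iff {Y : Type u} [AddCommGroup Y] [Module R Y]
    (hAB : ∀ i, 1 ≤ i → TorVanishes R A B i) (hBY : ∀ i, 1 ≤ i → TorVanishes R B Y i) :
    (∀ i, 1 ≤ i → TorVanishes R (A ⊗[R] B) Y i) ↔
      ∀ i, 1 ≤ i → TorVanishes R A (B ⊗[R] Y) i := by
  rw [← forall_torAcyclic_iff] at hAB hBY ⊢
  rw [← forall_torAcyclic_iff]
  exact ⟨fun h n => .tensor_right hAB hBY (h n), fun h n => .tensor_left hAB hBY (h n)⟩

end Tor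

/-- `M^{⊗ 1} ≃ M`. -/
noncomputable def tpowOneEquiv (R : Type u) [CommRing R] (M : Type u) [AddCommGroup M]
    [Module R M] : tpow R M 1 ≃ₗ[R] M :=
  TensorProduct.rid R M

lemma nonempty_tpow_add_equiv (R : Type u) [CommRing R] (M : Type u) [AddCommGroup M]
    [Module R M] (s j : ℕ) :
    Nonempty ((tpow R M s ⊗[R] tpow R M j) ≃ₗ[R] tpow R M (s + j)) := by
  induction s with
  | zero =>
    rw [Nat.zero_add]
    exact ⟨TensorProduct.lid R (tpow R M j)⟩
  | succ s ih =>
    obtain ⟨e⟩ := ih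
    rw [Nat.succ_add]
    exact ⟨(TensorProduct.assoc R M (tpow R M s) (tpow R M j)).trans (e.lTensor M)⟩

/-- Let `R` be a commutative noetherian ring and `M` a finitely generated `R`-module with
`Tor_i^R(M, M^{⊗_R j}) = 0` for all `i, j ≥ 1`. For every finitely generated `R`-module
`Y`, the following are equivalent: (1) `Tor_i^R(M, M^{⊗_R j} ⊗_R Y) = 0` for `i ≥ 1`,
`j ≥ 0`; (2) `Tor_i^R(M^{⊗_R s}, M^{⊗_R j} ⊗_R Y) = 0` for `i, s ≥ 1`, `j ≥ 0`;
(3) `Tor_i^R(M^{⊗_R s}, Y) = 0` for `i, s ≥ 1`. -/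
theorem stmt_18 (R : Type u) [CommRing R] [IsNoetherianRing R]
    (M : Type u) [AddCommGroup M] [Module R M] [Module.Finite R M]
    (hP : ∀ i j : ℕ, 1 ≤ i → 1 ≤ j → TorVanishes R M (tpow R M i) j)
    (Y : Type u) [AddCommGroup Y] [Module R Y] [Module.Finite R Y] :
    ((∀ i j : ℕ, 1 ≤ i → TorVanishes R M ((tpow R M j) ⊗[R] Y) i) ↔
      (∀ i s j : ℕ, 1 ≤ i → 1 ≤ s → TorVanishes R (tpow R M s) ((tpow R M j) ⊗[R] Y) i)) ∧
    ((∀ i s j : ℕ, 1 ≤ i → 1 ≤ s → TorVanishes R (tpow R M s) ((tpow R M j) ⊗[R] Y) i) ↔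
      (∀ i s : ℕ, 1 ≤ i → 1 ≤ s → TorVanishes R (tpow R M s) Y i)) := by
  have torM {s : ℕ} (hs : 1 ≤ s) (i : ℕ) (hi : 1 ≤ i) : TorVanishes R M (tpow R M s) i :=
    hP s i hs hi
  have h12 (h : ∀ i j : ℕ, 1 ≤ i → TorVanishes R M ((tpow R M j) ⊗[R] Y) i) (s : ℕ)
      (hs : 1 ≤ s) : ∀ j i : ℕ, 1 ≤ i → TorVanishes R (tpow R M s) ((tpow R M j) ⊗[R] Y) i := by
    induction s, hs using Nat.le_induction with
    | base =>
      intro j i hi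
      exact (h i j hi).congr (tpowOneEquiv R M).symm (.refl R _)
    | succ s hs ih =>
      intro j
      refine (forall_torVanishes_tensor_iff (torM hs) (ih j)).2 fun i hi => ?_
      obtain ⟨e⟩ := nonempty_tpow_add_equiv R M s j
      exact (h i (s + j) hi).congr (.refl R M)
        ((e.symm.rTensor Y).trans (TensorProduct.assoc R (tpow R M s) (tpow R M j) Y))
  have h31 (h : ∀ i s : ℕ, 1 ≤ i → 1 ≤ s → TorVanishes R (tpow R M s) Y i) :
      ∀ j i : ℕ, 1 ≤ i → TorVanishes R M ((tpow R M j) ⊗[R] Y) i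
    | 0, i, hi => (h i 1 hi le_rfl).congr (tpowOneEquiv R M) (TensorProduct.lid R Y).symm
    | j + 1, i, hi => (forall_torVanishes_tensor_iff (torM j.succ_pos)
        fun i hi => h i (j + 1) hi j.succ_pos).1 (fun i hi => h i (j + 2) hi (by omega)) i hi
  have h23 (h : ∀ i s j : ℕ, 1 ≤ i → 1 ≤ s →
      TorVanishes R (tpow R M s) ((tpow R M j) ⊗[R] Y) i) (i s : ℕ) (hi : 1 ≤ i) (hs : 1 ≤ s) :
      TorVanishes R (tpow R M s) Y i :=
    (h i s 0 hi hs).congr (.refl R _) (TensorProduct.lid R Y)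
  exact ⟨⟨fun h i s j hi hs => h12 h s hs j i hi, fun h i j hi => h31 (h23 h) j i hi⟩,
    h23, fun h i s j hi hs => h12 (fun i j hi => h31 h j i hi) s hs j i hi⟩
end

section
/- Let R be a commutative noetherian ring and let M and Y be finitely generated R-modules with Tor_i^R(M, Y) = 0 for all i ≥ 1. If the projective dimension of M is at most m and the projective dimension of Y is at most n, then the projective dimension of M ⊗_R Y is at most m + n. -/
open CategoryTheory TensorProduct

universe u

namespace ModuleCat

variable {R : Type u} [CommRing R]

/-- A left resolution `X` of `A` vanishing above degree `n`, all of whose terms have projective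
dimension at most `m`, bounds the projective dimension of `A` by `m + n`. -/
lemma hasProjectiveDimensionLE_of_resolution (m n : ℕ) (A : Type u) [AddCommGroup A] [Module R A]
    (X : ℕ → ModuleCat.{u} R) (d : ∀ i, X (i + 1) →ₗ[R] X i) (ε : X 0 →ₗ[R] A)
    (hX : ∀ i, HasProjectiveDimensionLE (X i) m) (hε : Function.Surjective ε)
    (h₀ : Function.Exact (d 0) ε) (hd : ∀ i, Function.Exact (d (i + 1)) (d i))
    (hn : ∀ i, n < i → Subsingleton (X i)) :
    HasProjectiveDimensionLE (of R A) (m + n) := by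
  induction n generalizing A X with
  | zero =>
    have := hn 1 one_pos
    have hinj : Function.Injective ε := by
      rw [injective_iff_map_eq_zero]
      intro x hx
      obtain ⟨y, rfl⟩ := (h₀ x).mp hx
      rw [Subsingleton.elim y 0, map_zero]
    have := hX 0
    exact hasProjectiveDimensionLE_of_linearEquiv (M := X 0) (N := of R A)
      (LinearEquiv.ofBijective ε ⟨hinj, hε⟩) m
  | succ n ih =>
    have hker : HasProjectiveDimensionLE (of R (LinearMap.ker ε)) (m + n) := by
      refine ih (LinearMap.ker ε) (fun i ↦ X (i + 1)) (fun i ↦ d (i + 1))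
        ((d 0).codRestrict (LinearMap.ker ε) fun x ↦ h₀.apply_apply_eq_zero x)
        (fun i ↦ hX (i + 1)) ?_ ?_ (fun i ↦ hd (i + 1)) (fun i hi ↦ hn (i + 1) (by omega))
      · rintro ⟨x, hx⟩
        obtain ⟨y, rfl⟩ := (h₀ x).mp hx
        exact ⟨y, rfl⟩
      · intro x
        rw [← hd 0 x, Subtype.ext_iff]
        rfl
    exact (LinearMap.shortExact_shortComplexKer hε).hasProjectiveDimensionLT_X₃ (m + n + 1) hker
      (have := hX 0; hasProjectiveDimensionLT_of_ge _ (m + 1) _ (by omega))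

/-- The projective resolution attached to an exact sequence of projective modules ending in `A`. -/
lemma exists_projectiveResolution (A : Type u) [AddCommGroup A] [Module R A]
    (P : ℕ → ModuleCat.{u} R) (d : ∀ i, P (i + 1) →ₗ[R] P i) (ε : P 0 →ₗ[R] A)
    (hP : ∀ i, Module.Projective R (P i)) (hε : Function.Surjective ε)
    (h₀ : Function.Exact (d 0) ε) (hd : ∀ i, Function.Exact (d (i + 1)) (d i)) :
    ∃ Q : ProjectiveResolution (of R A), Q.complex =
      ChainComplex.of P (fun i ↦ ofHom (d i))
        (fun i ↦ hom_ext (hd i).linearMap_comp_eq_zero) := by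
  let K := ChainComplex.of P (fun i ↦ ofHom (d i))
    (fun i ↦ hom_ext (hd i).linearMap_comp_eq_zero)
  have hK (i : ℕ) : K.d (i + 1) i = ofHom (d i) :=
    ChainComplex.of_d P (fun i ↦ ofHom (d i)) i
  have hKε : K.d 1 0 ≫ ofHom ε = 0 := by
    rw [hK 0]; exact hom_ext h₀.linearMap_comp_eq_zero
  let π : K ⟶ (ChainComplex.single₀ _).obj (of R A) :=
    (ChainComplex.toSingle₀Equiv K (of R A)).symm ⟨ofHom ε, hKε⟩
  have hπ : π.f 0 = ofHom ε := ChainComplex.toSingle₀Equiv_symm_apply_f_zero _ _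
  refine ⟨{ complex := K, projective := fun i ↦ (IsProjective.iff_projective (P i)).mp (hP i),
            π := π, quasiIso := ⟨fun i ↦ ?_⟩ }, rfl⟩
  cases i with
  | zero =>
    rw [ChainComplex.quasiIsoAt₀_iff, ShortComplex.quasiIso_iff_of_zeros' _ rfl rfl rfl]
    constructor
    · apply shortComplex_exact
      change Function.Exact (K.d 1 0) (π.f 0)
      rw [hK 0, hπ]
      exact h₀
    · change Epi (π.f 0)
      rw [hπ]
      exact (epi_iff_surjective _).mpr hε
  | succ i =>
    rw [quasiIsoAt_iff_exactAt' (hL := ChainComplex.exactAt_succ_single_obj ..),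
      HomologicalComplex.exactAt_iff' _ (i + 2) (i + 1) i (by simp) (by simp)]
    apply shortComplex_exact
    change Function.Exact (K.d (i + 2) (i + 1)) (K.d (i + 1) i)
    rw [hK, hK]
    exact hd i

/-- If `Tor_i(M, A)` vanishes then `M ⊗ P` is exact in degree `i ≥ 1` for every projective
resolution `P` of `A`. -/
lemma lTensor_exact_of_torVanishes (M A : Type u) [AddCommGroup M] [Module R M]
    [AddCommGroup A] [Module R A]
    (P : ℕ → ModuleCat.{u} R) (d : ∀ i, P (i + 1) →ₗ[R] P i) (ε : P 0 →ₗ[R] A)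
    (hP : ∀ i, Module.Projective R (P i)) (hε : Function.Surjective ε)
    (h₀ : Function.Exact (d 0) ε) (hd : ∀ i, Function.Exact (d (i + 1)) (d i))
    (i : ℕ) (hTor : TorVanishes R M A (i + 1)) :
    Function.Exact ((d (i + 1)).lTensor M) ((d i).lTensor M) := by
  obtain ⟨Q, hQ⟩ := exists_projectiveResolution A P d ε hP hε h₀ hd
  let F := (MonoidalCategory.tensoringLeft (ModuleCat.{u} R)).obj (of R M)
  have hzero : Limits.IsZero ((F.leftDerived (i + 1)).obj (of R A)) := by
    rw [isZero_iff_subsingleton]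
    exact hTor
  have hex : ((F.mapHomologicalComplex _).obj Q.complex).ExactAt (i + 1) := by
    rw [HomologicalComplex.exactAt_iff_isZero_homology]
    exact hzero.of_iso (Q.isoLeftDerivedObj F (i + 1)).symm
  rw [hQ, HomologicalComplex.exactAt_iff' _ (i + 2) (i + 1) i (by simp) (by simp),
    ShortComplex.ShortExact.moduleCat_exact_iff_function_exact] at hex
  change Function.Exact (F.map (ChainComplex.of.d P _ (i + 1 + 1) (i + 1)))
    (F.map (ChainComplex.of.d P _ (i + 1) i)) at hex
  rw [ChainComplex.of_d, ChainComplex.of_d] at hex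
  exact hex

end ModuleCat

lemma HasPdLE.hasProjectiveDimensionLE_tensor {R : Type u} [CommRing R] {M : Type u}
    [AddCommGroup M] [Module R M] {m : ℕ} (hM : HasPdLE R M m)
    (P : Type u) [AddCommGroup P] [Module R P] [Module.Projective R P] :
    HasProjectiveDimensionLE (ModuleCat.of R (M ⊗[R] P)) m := by
  obtain ⟨Q, d, ε, hQ, -, hε, h₀, hd, hm⟩ := hM
  rw [← zero_add m]
  refine ModuleCat.hasProjectiveDimensionLE_of_resolution 0 m (M ⊗[R] P)
    (fun i ↦ ModuleCat.of R (Q i ⊗[R] P)) (fun i ↦ (d i).rTensor P) (ε.rTensor P)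
    (fun i ↦ ?_) (LinearMap.rTensor_surjective P hε)
    (Module.Flat.rTensor_exact P (LinearMap.exact_iff.mpr h₀))
    (fun i ↦ Module.Flat.rTensor_exact P (LinearMap.exact_iff.mpr (hd i)))
    (fun i hi ↦ have := hm i hi; inferInstanceAs (Subsingleton (Q i ⊗[R] P)))
  have := hQ i
  rw [← projective_iff_hasProjectiveDimensionLE_zero, ← IsProjective.iff_projective]
  exact inferInstanceAs (Module.Projective R (Q i ⊗[R] P))

lemma HasPdLE.of_linearMap_ker {S : Type u} [Ring S] {X F : Type u} [AddCommGroup X] [Module S X]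
    [AddCommGroup F] [Module S F] [Module.Projective S F] [Module.Finite S F] (f : F →ₗ[S] X)
    (hf : Function.Surjective f) {n : ℕ} (hK : HasPdLE S (LinearMap.ker f) n) :
    HasPdLE S X (n + 1) := by
  obtain ⟨P, d, ε, hP, hfin, hε, h₀, hd, hn⟩ := hK
  let P' : ℕ → ModuleCat.{u} S
    | 0 => ModuleCat.of S F
    | i + 1 => P i
  let d' : ∀ i : ℕ, P' (i + 1) →ₗ[S] P' i := by
    rintro (_ | i)
    exacts [(LinearMap.ker f).subtype ∘ₗ ε, d i]
  refine ⟨P', d', f, ?_, ?_, hf, ?_, ?_, ?_⟩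
  · rintro (_ | i)
    exacts [inferInstanceAs (Module.Projective S F), hP i]
  · rintro (_ | i)
    exacts [inferInstanceAs (Module.Finite S F), hfin i]
  · change _ = LinearMap.range ((LinearMap.ker f).subtype ∘ₗ ε)
    rw [LinearMap.range_comp, LinearMap.range_eq_top.mpr hε, Submodule.map_top,
      Submodule.range_subtype]
  · rintro (_ | i)
    · change LinearMap.ker ((LinearMap.ker f).subtype ∘ₗ ε) = LinearMap.range (d 0)
      rw [LinearMap.ker_comp_of_ker_eq_bot _ (Submodule.ker_subtype _), h₀]
    · exact hd i
  · rintro (_ | i) hi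
    exacts [absurd hi (by omega), hn i (by omega)]

lemma HasPdLE.of_projective {S : Type u} [Ring S] (X : Type u) [AddCommGroup X] [Module S X]
    [Module.Projective S X] [Module.Finite S X] : HasPdLE S X 0 := by
  let P : ℕ → ModuleCat.{u} S := fun i ↦ Nat.casesOn i (ModuleCat.of S X)
    fun _ ↦ ModuleCat.of S PUnit.{u + 1}
  have hsub (i : ℕ) : Subsingleton (P (i + 1)) := inferInstanceAs (Subsingleton PUnit.{u + 1})
  refine ⟨P, fun i ↦ 0, (LinearMap.id : X →ₗ[S] X), ?_, ?_, Function.surjective_id, ?_, ?_, ?_⟩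
  · rintro (_ | i)
    exacts [inferInstanceAs (Module.Projective S X), inferInstanceAs (Module.Projective S PUnit.{u + 1})]
  · rintro (_ | i)
    exacts [inferInstanceAs (Module.Finite S X), inferInstanceAs (Module.Finite S PUnit.{u + 1})]
  · change LinearMap.ker (LinearMap.id : X →ₗ[S] X) =
      LinearMap.range (0 : PUnit.{u + 1} →ₗ[S] X)
    rw [LinearMap.ker_id, LinearMap.range_zero]
  · intro i
    exact Subsingleton.elim _ _
  · rintro (_ | i) hi
    exacts [absurd hi (by omega), hsub i]

lemma HasPdLE.of_hasProjectiveDimensionLE {R : Type u} [CommRing R] [IsNoetherianRing R] (n : ℕ)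
    (X : Type u) [AddCommGroup X] [Module R X] [Module.Finite R X]
    (h : HasProjectiveDimensionLE (ModuleCat.of R X) n) : HasPdLE R X n := by
  induction n generalizing X with
  | zero =>
    rw [← projective_iff_hasProjectiveDimensionLE_zero, ← IsProjective.iff_projective] at h
    have : Module.Projective R X := h
    exact .of_projective X
  | succ n ih =>
    obtain ⟨F, _, _, _, _, f, hf⟩ := Module.exists_finite_presentation R X
    have hproj := ModuleCat.projective_of_categoryTheory_projective f.shortComplexKer.X₂
    exact .of_linearMap_ker f hf (ih _
      (((LinearMap.shortExact_shortComplexKer hf).hasProjectiveDimensionLT_X₃_iff n hproj).mp h))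

/-- Let `R` be a commutative noetherian ring and `M`, `Y` finitely generated `R`-modules
with `Tor_i^R(M, Y) = 0` for all `i ≥ 1`. If `pd M ≤ m` and `pd Y ≤ n`, then
`pd (M ⊗_R Y) ≤ m + n`. -/
theorem stmt_19 (R : Type u) [CommRing R] [IsNoetherianRing R]
    (M Y : Type u) [AddCommGroup M] [Module R M] [Module.Finite R M]
    [AddCommGroup Y] [Module R Y] [Module.Finite R Y]
    (hTor : ∀ i : ℕ, 1 ≤ i → TorVanishes R M Y i)
    (m n : ℕ) (hM : HasPdLE R M m) (hY : HasPdLE R Y n) :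
    HasPdLE R (M ⊗[R] Y) (m + n) := by
  obtain ⟨P, d, ε, hP, -, hε, h₀, hd, hn⟩ := hY
  replace h₀ : Function.Exact (d 0) ε := LinearMap.exact_iff.mpr h₀
  replace hd (i : ℕ) : Function.Exact (d (i + 1)) (d i) := LinearMap.exact_iff.mpr (hd i)
  refine .of_hasProjectiveDimensionLE _ _ ?_
  exact ModuleCat.hasProjectiveDimensionLE_of_resolution m n (M ⊗[R] Y)
    (fun i ↦ ModuleCat.of R (M ⊗[R] P i)) (fun i ↦ (d i).lTensor M) (ε.lTensor M)
    (fun i ↦ have := hP i; hM.hasProjectiveDimensionLE_tensor (P i))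
    (LinearMap.lTensor_surjective M hε) (lTensor_exact M h₀ hε)
    (fun i ↦ ModuleCat.lTensor_exact_of_torVanishes M Y P d ε hP hε h₀ hd i
      (hTor (i + 1) (by omega)))
    (fun i hi ↦ have := hn i hi; inferInstanceAs (Subsingleton (M ⊗[R] P i)))
end
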